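/- arXiv:1602.01451 — 8 statements merged into one kernel-verified Lean document; each statement's English description precedes it below -/
import Mathlib

section
/- Let m and n be coprime positive integers and let i be an integer. Consider the subsets M of ℤ that are nonempty, bounded below, and satisfy M + m ⊆ M and M + n ⊆ M. For every such M the sets M \ ℤ≥0 and ℤ≥0 \ M are finite, so the index [M : ℤ≥0] := #(M \ ℤ≥0) − #(ℤ≥0 \ M) is a well-defined integer. Then the collection of such subsets M with [M : ℤ≥0] = i is finite and has exactly (1/(m+n))·binom(m+n, n) elements. -/
/-- `M ⊆ ℤ` is a module over the monoid `A_{m,n} = ℤ≥0·m + ℤ≥0·n`: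
nonempty, bounded below, and stable under adding `m` and `n`. -/
def IsAmod (m n : ℕ) (M : Set ℤ) : Prop :=
  M.Nonempty ∧ BddBelow M ∧ (∀ x ∈ M, x + (m : ℤ) ∈ M) ∧ (∀ x ∈ M, x + (n : ℤ) ∈ M)

/-- The index `[M : ℤ≥0] = #(M \ ℤ≥0) − #(ℤ≥0 \ M)`. -/
noncomputable def amodIdx (M : Set ℤ) : ℤ :=
  ((M \ {j : ℤ | 0 ≤ j}).ncard : ℤ) - (({j : ℤ | 0 ≤ j} \ M).ncard : ℤ)

/-- The integers lying above the threshold that `f` assigns to their residue class modulo `s`. -/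
def residueUpperSet {s : ℕ} (f : ZMod s → ℤ) : Set ℤ := {x | f (x : ZMod s) ≤ x}

/-- Closed cyclic walks in `ℤ` with `m + n` steps, each equal to `m` or `-n`, and with vertex
sum `c`. -/
def cyclicWalks (m n : ℕ) [NeZero (m + n)] (c : ℤ) : Set (ZMod (m + n) → ℤ) :=
  {g | (∀ k, g (k + 1) - g k = m ∨ g (k + 1) - g k = -n) ∧ ∑ k, g k = c}

/-- Families of generators, one in each residue class modulo `m + n`, of `A_{m,n}`-submodules
of `ℤ`, with sum `c`. -/
def generatorFamilies (m n : ℕ) [NeZero (m + n)] (c : ℤ) : Set (ZMod (m + n) → ℤ) :=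
  {f | (∀ r, (f r : ZMod (m + n)) = r) ∧
    (∀ r, f (r + m) - f r = m ∨ f (r + m) - f r = -n) ∧ ∑ r, f r = c}

theorem residueUpperSet_injOn {s : ℕ} :
    Set.InjOn (residueUpperSet (s := s)) {f | ∀ r, (f r : ZMod s) = r} := by
  intro f hf f' hf' h
  have key : ∀ g g' : ZMod s → ℤ, (∀ r, (g r : ZMod s) = r) →
      residueUpperSet g = residueUpperSet g' → ∀ r, g' r ≤ g r := by
    intro g g' hg h r
    have h1 : g r ∈ residueUpperSet g := by simp [residueUpperSet, hg]
    rw [h] at h1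
    simpa [residueUpperSet, hg] using h1
  funext r
  exact le_antisymm (key f' f hf' h.symm r) (key f f' hf h r)

theorem residueUpperSet_val {s : ℕ} [NeZero s] :
    residueUpperSet (fun r : ZMod s => (r.val : ℤ)) = {j : ℤ | 0 ≤ j} := by
  have hs : (0 : ℤ) < s := by exact_mod_cast Nat.pos_of_ne_zero (NeZero.ne s)
  ext x
  simp only [residueUpperSet, Set.mem_ofPred_eq, ZMod.val_intCast]
  constructor
  · intro h
    exact (Int.emod_nonneg _ hs.ne').trans h
  · intro h
    have := Int.mul_nonneg hs.le (Int.ediv_nonneg h hs.le)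
    linarith [Int.mul_ediv_add_emod x s]

theorem dvd_sub_of_intCast_eq {s : ℕ} {a b : ℤ} (h : (a : ZMod s) = b) : (s : ℤ) ∣ b - a :=
  (ZMod.intCast_eq_intCast_iff_dvd_sub a b s).1 h

theorem residueUpperSet_sdiff {s : ℕ} [NeZero s] {f f' : ZMod s → ℤ}
    (hf : ∀ r, (f r : ZMod s) = r) (hf' : ∀ r, (f' r : ZMod s) = r) :
    (residueUpperSet f \ residueUpperSet f').Finite ∧
      (residueUpperSet f \ residueUpperSet f').ncard = ∑ r, ((f' r - f r) / s).toNat := by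
  classical
  have hs : (0 : ℤ) < s := by exact_mod_cast Nat.pos_of_ne_zero (NeZero.ne s)
  set e : (Σ _ : ZMod s, ℕ) → ℤ := fun p => f p.1 + s * p.2 with he
  have hcast : ∀ p, (e p : ZMod s) = p.1 := by intro p; simp [he, hf]
  have heq : residueUpperSet f \ residueUpperSet f' =
      (((Finset.univ : Finset (ZMod s)).sigma
        fun r => Finset.range ((f' r - f r) / s).toNat).image e : Finset ℤ) := by
    ext x
    simp only [residueUpperSet, Set.mem_sdiff, Set.mem_ofPred_eq, not_le, Finset.coe_image,
      Set.mem_image, Finset.mem_coe, Finset.mem_sigma, Finset.mem_univ, true_and,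
      Finset.mem_range]
    constructor
    · rintro ⟨h1, h2⟩
      obtain ⟨j, hj⟩ := dvd_sub_of_intCast_eq (hf (x : ZMod s))
      obtain ⟨t, ht⟩ := dvd_sub_of_intCast_eq ((hf (x : ZMod s)).trans (hf' x).symm)
      have hj0 : 0 ≤ j := by nlinarith
      have hjt : j < t := by nlinarith
      refine ⟨⟨x, j.toNat⟩, ?_, ?_⟩
      · simp only [ht, Int.mul_ediv_cancel_left _ hs.ne']
        omega
      · simp only [he, Int.toNat_of_nonneg hj0]
        linarith
    · rintro ⟨⟨r, j⟩, h, rfl⟩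
      rw [hcast]
      obtain ⟨t, ht⟩ := dvd_sub_of_intCast_eq ((hf r).trans (hf' r).symm)
      simp only [ht, Int.mul_ediv_cancel_left _ hs.ne'] at h
      have hjt : (j : ℤ) < t := by omega
      have : (s : ℤ) * j < s * t := by nlinarith
      have : 0 ≤ (s : ℤ) * j := by positivity
      simp only [he]
      constructor <;> linarith
  have hinj : Function.Injective e := by
    rintro ⟨r, j⟩ ⟨r', j'⟩ h
    obtain rfl : r = r' := (hcast ⟨r, j⟩).symm.trans ((congrArg _ h).trans (hcast ⟨r', j'⟩))
    have : (s : ℤ) * j = s * j' := by simpa [he] using h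
    have : j = j' := by exact_mod_cast mul_left_cancel₀ hs.ne' this
    rw [this]
  rw [heq]
  refine ⟨Finset.finite_toSet _, ?_⟩
  rw [Set.ncard_coe_finset, Finset.card_image_of_injective _ hinj, Finset.card_sigma]
  simp

theorem amodIdx_residueUpperSet {s : ℕ} [NeZero s] {f : ZMod s → ℤ}
    (hf : ∀ r, (f r : ZMod s) = r) :
    s * amodIdx (residueUpperSet f) = ∑ r : ZMod s, (r.val : ℤ) - ∑ r, f r := by
  have hv : ∀ r : ZMod s, (((r.val : ℕ) : ℤ) : ZMod s) = r := by intro r; simp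
  rw [amodIdx, ← residueUpperSet_val (s := s), (residueUpperSet_sdiff hf hv).2,
    (residueUpperSet_sdiff hv hf).2, ← Finset.sum_sub_distrib]
  push_cast
  rw [← Finset.sum_sub_distrib, Finset.mul_sum]
  refine Finset.sum_congr rfl fun r _ => ?_
  have hs : (s : ℤ) ≠ 0 := by exact_mod_cast NeZero.ne s
  obtain ⟨t, ht⟩ := dvd_sub_of_intCast_eq ((hf r).trans (hv r).symm)
  have ht' : f r - r.val = s * (-t) := by linarith
  rw [ht, ht', Int.mul_ediv_cancel_left _ hs, Int.mul_ediv_cancel_left _ hs]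
  congr 1
  omega

theorem natCast_mul_inv_of_coprime {m n : ℕ} (hmn : Nat.Coprime m n) :
    (m : ZMod (m + n)) * (m : ZMod (m + n))⁻¹ = 1 :=
  ZMod.coe_mul_inv_eq_one m (by simpa using hmn)

theorem IsAmod.exists_eq_residueUpperSet {m n : ℕ} [NeZero (m + n)] (hmn : Nat.Coprime m n)
    {M : Set ℤ} (hM : IsAmod m n M) :
    ∃ f : ZMod (m + n) → ℤ, (∀ r, (f r : ZMod (m + n)) = r) ∧ residueUpperSet f = M := by
  obtain ⟨⟨x, hx⟩, ⟨b, hb⟩, h1, h2⟩ := hM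
  have hmul : ∀ j : ℕ, x + m * j ∈ M := by
    intro j
    induction j with
    | zero => simpa using hx
    | succ j ih => convert h1 _ ih using 1; push_cast; ring
  have hadd : ∀ y ∈ M, ∀ j : ℕ, y + ((m + n : ℕ) : ℤ) * j ∈ M := by
    intro y hy j
    induction j with
    | zero => simpa using hy
    | succ j ih => convert h2 _ (h1 _ ih) using 1; push_cast; ring
  have hex : ∀ r : ZMod (m + n), ∃ y : ℤ, (y ∈ M ∧ (y : ZMod (m + n)) = r) ∧
      ∀ z : ℤ, z ∈ M ∧ (z : ZMod (m + n)) = r → y ≤ z := by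
    intro r
    refine Int.exists_least_of_bdd ⟨b, fun z hz => hb hz.1⟩
      ⟨x + m * ((((m : ZMod (m + n))⁻¹ * (r - x)).val : ℕ) : ℤ), hmul _, ?_⟩
    push_cast
    rw [ZMod.natCast_zmod_val, ← mul_assoc, natCast_mul_inv_of_coprime hmn]
    ring
  choose f hf hmin using hex
  refine ⟨f, fun r => (hf r).2, ?_⟩
  have hs : (0 : ℤ) < (m + n : ℕ) := by exact_mod_cast Nat.pos_of_ne_zero (NeZero.ne (m + n))
  ext y
  constructor
  · intro hy
    obtain ⟨j, hj⟩ := dvd_sub_of_intCast_eq (hf (y : ZMod (m + n))).2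
    have hy' : f y ≤ y := hy
    have hj0 : 0 ≤ j := by nlinarith
    have := hadd _ (hf (y : ZMod (m + n))).1 j.toNat
    rw [Int.toNat_of_nonneg hj0, ← hj] at this
    simpa using this
  · intro hy
    exact hmin _ y ⟨hy, rfl⟩

theorem isAmod_residueUpperSet_iff {m n : ℕ} [NeZero (m + n)] {f : ZMod (m + n) → ℤ}
    (hf : ∀ r, (f r : ZMod (m + n)) = r) :
    IsAmod m n (residueUpperSet f) ↔
      ∀ r, f (r + m) - f r = m ∨ f (r + m) - f r = -n := by
  have hs : (0 : ℤ) < (m + n : ℕ) := by exact_mod_cast Nat.pos_of_ne_zero (NeZero.ne (m + n))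
  have hzero : (m : ZMod (m + n)) + n = 0 := by
    rw [← Nat.cast_add, ZMod.natCast_self]
  have hself : ∀ r, f r ∈ residueUpperSet f := by intro r; simp [residueUpperSet, hf]
  constructor
  · rintro ⟨-, -, h1, h2⟩ r
    have ha : f (r + m) ≤ f r + m := by
      simpa [residueUpperSet, hf] using h1 _ (hself r)
    have hb : f r ≤ f (r + m) + n := by
      simpa [residueUpperSet, hf, add_assoc, hzero] using h2 _ (hself (r + m))
    obtain ⟨t, ht⟩ := dvd_sub_of_intCast_eq (s := m + n) (a := f r + m) (b := f (r + m))
      (by push_cast; rw [hf, hf])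
    have ht0 : t ≤ 0 := by nlinarith
    have ht1 : -1 ≤ t := by push_cast at *; nlinarith
    obtain rfl | rfl : t = 0 ∨ t = -1 := by omega
    · left; linarith
    · right; push_cast at ht; linarith
  · intro h
    refine ⟨⟨f 0, hself 0⟩, ?_, ?_, ?_⟩
    · obtain ⟨b, hb⟩ := (Set.finite_range f).bddBelow
      exact ⟨b, fun x hx => (hb ⟨_, rfl⟩).trans hx⟩
    · intro x hx
      simp only [residueUpperSet, Set.mem_ofPred_eq] at hx ⊢
      push_cast
      rcases h (x : ZMod (m + n)) with h | h <;> omega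
    · intro x hx
      simp only [residueUpperSet, Set.mem_ofPred_eq] at hx ⊢
      push_cast
      have h' := h ((x : ZMod (m + n)) + n)
      rw [add_assoc, add_comm (n : ZMod (m + n)), hzero, add_zero] at h'
      rcases h' with h' | h' <;> omega

theorem bijOn_residueUpperSet {m n : ℕ} [NeZero (m + n)] (hmn : Nat.Coprime m n) (i : ℤ) :
    Set.BijOn residueUpperSet
      (generatorFamilies m n (∑ r : ZMod (m + n), (r.val : ℤ) - (m + n : ℕ) * i))
      {M | IsAmod m n M ∧ amodIdx M = i} := by
  have hs : ((m + n : ℕ) : ℤ) ≠ 0 := by exact_mod_cast NeZero.ne (m + n)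
  refine ⟨?_, residueUpperSet_injOn.mono fun f hf => hf.1, ?_⟩
  · rintro f ⟨hf, hstep, hsum⟩
    refine ⟨(isAmod_residueUpperSet_iff hf).2 hstep, mul_left_cancel₀ hs ?_⟩
    rw [amodIdx_residueUpperSet hf, hsum]
    ring
  · rintro M ⟨hM, hi⟩
    obtain ⟨f, hf, rfl⟩ := hM.exists_eq_residueUpperSet hmn
    refine ⟨f, ⟨hf, (isAmod_residueUpperSet_iff hf).1 hM, ?_⟩, rfl⟩
    have := amodIdx_residueUpperSet hf
    rw [hi] at this
    linarith

theorem zmod_eq_add_mul_of_step {s : ℕ} [NeZero s] {R : Type*} [CommRing R] (φ : ZMod s →+* R)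
    {g : ZMod s → R} {a : R} (h : ∀ k, g (k + 1) = g k + a) (k : ZMod s) :
    g k = g 0 + φ k * a := by
  have key : ∀ j : ℕ, g (j : ZMod s) = g 0 + j * a := by
    intro j
    induction j with
    | zero => simp
    | succ j ih => push_cast; rw [h, ih]; ring
  have := key k.val
  rw [ZMod.natCast_zmod_val] at this
  rw [this, ← map_natCast φ, ZMod.natCast_zmod_val]

theorem cyclicWalk_intCast {m n : ℕ} [NeZero (m + n)] {g : ZMod (m + n) → ℤ}
    (hg : ∀ k, g (k + 1) - g k = m ∨ g (k + 1) - g k = -n) (k : ZMod (m + n)) :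
    (g k : ZMod (m + n)) = g 0 + k * m := by
  have hzero : (m : ZMod (m + n)) + n = 0 := by
    rw [← Nat.cast_add, ZMod.natCast_self]
  refine zmod_eq_add_mul_of_step (RingHom.id _) (g := fun k => (g k : ZMod (m + n))) ?_ k
  intro k
  rcases hg k with h | h
  · rw [sub_eq_iff_eq_add'.1 h]; push_cast; ring
  · rw [sub_eq_iff_eq_add'.1 h]; push_cast; linear_combination -hzero

theorem bijOn_cyclicWalks {m n : ℕ} [NeZero (m + n)] (hmn : Nat.Coprime m n) (c : ℤ) :
    Set.BijOn (fun (p : (ZMod (m + n) → ℤ) × ZMod (m + n)) k => p.1 (p.2 + k * m))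
      (generatorFamilies m n c ×ˢ Set.univ) (cyclicWalks m n c) := by
  have hinv := natCast_mul_inv_of_coprime hmn
  set u : ZMod (m + n) := (m : ZMod (m + n))⁻¹
  have hperm : ∀ r₀ : ZMod (m + n), Function.Bijective fun k : ZMod (m + n) => r₀ + k * m := by
    intro r₀
    refine Function.bijective_iff_has_inverse.2 ⟨fun r => (r - r₀) * u, fun k => ?_, fun r => ?_⟩
    · linear_combination k * hinv
    · linear_combination (r - r₀) * hinv
  refine ⟨?_, ?_, ?_⟩
  · rintro ⟨f, r₀⟩ ⟨⟨hf, hstep, hsum⟩, -⟩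
    refine ⟨fun k => ?_, ?_⟩
    · have := hstep (r₀ + k * m)
      rwa [show r₀ + k * m + m = r₀ + (k + 1) * m by ring] at this
    · exact ((hperm r₀).sum_comp f).trans hsum
  · rintro ⟨f, r₀⟩ ⟨⟨hf, -⟩, -⟩ ⟨f', r₀'⟩ ⟨⟨hf', -⟩, -⟩ h
    dsimp only at h hf hf'
    have h0 : r₀ = r₀' := by
      have := congrArg (Int.cast : ℤ → ZMod (m + n)) (congrFun h 0)
      simpa [hf, hf'] using this
    subst h0
    have : f = f' := by
      funext r
      obtain ⟨k, rfl⟩ := (hperm r₀).surjective r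
      exact congrFun h k
    rw [this]
  · rintro g ⟨hstep, hsum⟩
    have hg := cyclicWalk_intCast hstep
    have hk : ∀ k : ZMod (m + n), ((g 0 : ZMod (m + n)) + k * m - g 0) * u = k := by
      intro k
      linear_combination k * hinv
    refine ⟨⟨fun r => g ((r - g 0) * u), g 0⟩, ⟨⟨fun r => ?_, fun r => ?_, ?_⟩, trivial⟩, ?_⟩
    · dsimp only
      rw [hg]
      linear_combination (r - g 0) * hinv
    · have := hstep ((r - g 0) * u)
      rwa [show (r - g 0) * u + 1 = (r + m - g 0) * u by linear_combination -hinv] at this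
    · rw [← hsum, ← (hperm (g 0 : ZMod (m + n))).sum_comp]
      exact Finset.sum_congr rfl fun k _ => congrArg g (hk k)
    · funext k
      dsimp only
      rw [hk]

theorem sum_zmod_eq_sum_range {s : ℕ} [NeZero s] (d : ZMod s → ℤ) :
    ∑ k, d k = ∑ j ∈ Finset.range s, d (j : ZMod s) := by
  refine Finset.sum_bij' (fun k _ => k.val) (fun j _ => (j : ZMod s)) ?_ ?_ ?_ ?_ ?_
  · intro k _; exact Finset.mem_range.2 k.val_lt
  · intro j _; exact Finset.mem_univ _
  · intro k _; simp
  · intro j hj; exact ZMod.val_cast_of_lt (Finset.mem_range.1 hj)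
  · intro k _; simp

theorem exists_cyclic_sub_eq {s : ℕ} [NeZero s] (d : ZMod s → ℤ) (hd : ∑ k, d k = 0) :
    ∃ h : ZMod s → ℤ, ∀ k, h (k + 1) - h k = d k := by
  refine ⟨fun k => ∑ j ∈ Finset.range k.val, d (j : ZMod s), fun k => ?_⟩
  have hsucc : ∑ j ∈ Finset.range (k.val + 1), d (j : ZMod s) =
      ∑ j ∈ Finset.range k.val, d (j : ZMod s) + d k := by
    rw [Finset.sum_range_succ, ZMod.natCast_zmod_val]
  have hk : (k + 1 : ZMod s) = ((k.val + 1 : ℕ) : ZMod s) := by simp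
  rcases (Nat.succ_le_of_lt k.val_lt).lt_or_eq with hlt | heq
  · dsimp only
    rw [hk, ZMod.val_cast_of_lt hlt, hsucc]
    ring
  · replace heq : k.val + 1 = s := heq
    have h0 : (k + 1 : ZMod s) = 0 := by rw [hk, heq, ZMod.natCast_self]
    rw [heq, ← sum_zmod_eq_sum_range, hd] at hsucc
    dsimp only
    rw [h0, ZMod.val_zero, Finset.sum_range_zero]
    linarith

theorem sum_ite_step {m n : ℕ} [NeZero (m + n)] (W : Finset (ZMod (m + n))) :
    ∑ k, (if k ∈ W then -(n : ℤ) else m) = (m + n : ℕ) * ((m : ℤ) - W.card) := by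
  have h : ∀ k, (if k ∈ W then -(n : ℤ) else m) =
      m - (if k ∈ W then ((m + n : ℕ) : ℤ) else 0) := by
    intro k
    split_ifs <;> push_cast <;> ring
  simp_rw [h]
  rw [Finset.sum_sub_distrib, Finset.sum_ite_mem]
  simp [ZMod.card]
  ring

theorem bijOn_powersetCard {m n : ℕ} [NeZero (m + n)] (hmn : Nat.Coprime m n) (i : ℤ) :
    Set.BijOn (fun g : ZMod (m + n) → ℤ => Finset.univ.filter fun k => g (k + 1) - g k = -n)
      (cyclicWalks m n (∑ r : ZMod (m + n), (r.val : ℤ) - (m + n : ℕ) * i))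
      (Finset.powersetCard m (Finset.univ : Finset (ZMod (m + n)))) := by
  have hs : (0 : ℤ) < (m + n : ℕ) := by exact_mod_cast Nat.pos_of_ne_zero (NeZero.ne (m + n))
  have hne : (m : ℤ) ≠ -n := by push_cast at hs; omega
  have hdiff : ∀ g : ZMod (m + n) → ℤ,
      (∀ k, g (k + 1) - g k = m ∨ g (k + 1) - g k = -n) → ∀ k, g (k + 1) - g k =
        if k ∈ Finset.univ.filter (fun k => g (k + 1) - g k = -(n : ℤ)) then -(n : ℤ) else m := by
    intro g hg k
    rcases hg k with h | h <;> simp [h, hne]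
  have hshift : ∀ g : ZMod (m + n) → ℤ, ∑ k, g (k + 1) = ∑ k, g k := fun g =>
    Equiv.sum_comp (Equiv.addRight (1 : ZMod (m + n))) g
  refine ⟨?_, ?_, ?_⟩
  · rintro g ⟨hg, -⟩
    rw [Finset.mem_coe, Finset.mem_powersetCard]
    refine ⟨Finset.subset_univ _, ?_⟩
    have h := Finset.sum_congr (rfl : (Finset.univ : Finset (ZMod (m + n))) = _)
      fun k _ => hdiff g hg k
    rw [Finset.sum_sub_distrib, hshift, sub_self, sum_ite_step] at h
    rcases mul_eq_zero.1 h.symm with h | h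
    · exact absurd h hs.ne'
    · dsimp only
      omega
  · rintro g ⟨hg, hgs⟩ g' ⟨hg', hgs'⟩ h
    dsimp only at h
    have hstep : ∀ k, g (k + 1) - g' (k + 1) = g k - g' k := by
      intro k
      have h1 := hdiff g hg k
      have h2 := hdiff g' hg' k
      rw [h] at h1
      linarith
    have hconst : ∀ j : ℕ, g (j : ZMod (m + n)) - g' j = g 0 - g' 0 := by
      intro j
      induction j with
      | zero => simp
      | succ j ih => push_cast; rw [hstep, ih]
    have hconst' : ∀ k, g k - g' k = g 0 - g' 0 := by
      intro k
      simpa using hconst k.val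
    have hsum : ∑ k, (g k - g' k) = 0 := by rw [Finset.sum_sub_distrib, hgs, hgs', sub_self]
    simp_rw [hconst'] at hsum
    rw [Finset.sum_const, Finset.card_univ, ZMod.card, nsmul_eq_mul] at hsum
    have h0 := (mul_eq_zero.1 hsum).resolve_left hs.ne'
    funext k
    linarith [hconst' k]
  · intro W hW
    rw [Finset.mem_coe, Finset.mem_powersetCard] at hW
    obtain ⟨h, hh⟩ := exists_cyclic_sub_eq (fun k => if k ∈ W then -(n : ℤ) else m)
      (by rw [sum_ite_step, hW.2]; ring)
    have hstep : ∀ k, h (k + 1) - h k = m ∨ h (k + 1) - h k = -n := by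
      intro k
      rw [hh]
      split_ifs <;> simp
    have hinv := natCast_mul_inv_of_coprime hmn
    have hbij : Function.Bijective fun k => (h k : ZMod (m + n)) := by
      refine (Finite.injective_iff_bijective).1 fun k k' hk => ?_
      rw [cyclicWalk_intCast hstep k, cyclicWalk_intCast hstep k'] at hk
      linear_combination (m : ZMod (m + n))⁻¹ * hk - (k - k') * hinv
    have hdvd : ((m + n : ℕ) : ℤ) ∣ ∑ r : ZMod (m + n), (r.val : ℤ) - ∑ k, h k := by
      rw [← hbij.sum_comp fun r => (r.val : ℤ), ← Finset.sum_sub_distrib]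
      exact Finset.dvd_sum fun k _ => dvd_sub_of_intCast_eq (by simp)
    obtain ⟨t, ht⟩ := hdvd
    refine ⟨fun k => h k + (t - i), ⟨fun k => ?_, ?_⟩, ?_⟩
    · simpa using hstep k
    · rw [Finset.sum_add_distrib, Finset.sum_const, Finset.card_univ, ZMod.card, nsmul_eq_mul]
      linarith
    · ext k
      have := hh k
      by_cases hk : k ∈ W <;> simp [this, hk, hne]

theorem stmt0 (m n : ℕ) (hm : 0 < m) (hn : 0 < n) (hmn : Nat.Coprime m n) (i : ℤ) :
    (∀ M : Set ℤ, IsAmod m n M →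
      (M \ {j : ℤ | 0 ≤ j}).Finite ∧ ({j : ℤ | 0 ≤ j} \ M).Finite) ∧
    {M : Set ℤ | IsAmod m n M ∧ amodIdx M = i}.Finite ∧
    {M : Set ℤ | IsAmod m n M ∧ amodIdx M = i}.ncard * (m + n) =
      Nat.choose (m + n) n := by
  have : NeZero (m + n) := ⟨by omega⟩
  have hX := bijOn_residueUpperSet hmn i
  have hF := bijOn_cyclicWalks hmn (∑ r : ZMod (m + n), (r.val : ℤ) - (m + n : ℕ) * i)
  have hP := bijOn_powersetCard hmn i
  refine ⟨fun M hM => ?_, ?_, ?_⟩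
  · obtain ⟨f, hf, rfl⟩ := hM.exists_eq_residueUpperSet hmn
    have hv : ∀ r : ZMod (m + n), (((r.val : ℕ) : ℤ) : ZMod (m + n)) = r := by intro r; simp
    rw [← residueUpperSet_val (s := m + n)]
    exact ⟨(residueUpperSet_sdiff hf hv).1, (residueUpperSet_sdiff hv hf).1⟩
  · have hfin := hF.finite_iff_finite.2 (hP.finite_iff_finite.2 (Finset.finite_toSet _))
    exact hX.finite_iff_finite.1 (hfin.of_prod_left ⟨0, trivial⟩)
  · have h1 := Set.ncard_congr' (hX.equiv _)
    have h2 := Set.ncard_congr' (hF.equiv _)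
    have h3 := Set.ncard_congr' (hP.equiv _)
    rw [Set.ncard_prod, Set.ncard_univ, Nat.card_zmod] at h2
    rw [Set.ncard_coe_finset, Finset.card_powersetCard, Finset.card_univ, ZMod.card] at h3
    rw [← h1, h2, h3, Nat.choose_symm_add]
end

section
/- Let R be a commutative ring and let f be a formal Laurent series over R (an element of R((t)), i.e., a Hahn series over ℤ with well-ordered support). (i) If there exists n ∈ ℤ such that the coefficient of tⁿ in f is a unit of R and for every j < n the coefficient of tʲ in f is nilpotent, then f is a unit of R((t)). (ii) If R is an integral domain, then f is a unit of R((t)) if and only if f ≠ 0 and the lowest-order nonzero coefficient of f is a unit of R. -/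
/-- A Laurent series whose lowest-order coefficients vanish up to a unit coefficient is a unit. -/
theorem LaurentSeries.isUnit_of_coeff_eq_zero {R : Type*} [CommRing R] {f : LaurentSeries R}
    {n : ℤ} (hn : IsUnit (f.coeff n)) (hf : ∀ j < n, f.coeff j = 0) : IsUnit f := by
  nontriviality R
  have hne : f.coeff n ≠ 0 := hn.ne_zero
  have hf0 : f ≠ 0 := by
    rintro rfl
    exact hne rfl
  have hord : f.order = n := by
    refine le_antisymm (HahnSeries.order_le_of_coeff_ne_zero hne) ?_
    by_contra! h
    exact HahnSeries.coeff_order_eq_zero.not.mpr hf0 (hf _ h)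
  refine HahnSeries.isUnit_of_isUnit_leadingCoeff_AddUnitOrder ?_ (AddGroup.isAddUnit _)
  rwa [HahnSeries.leadingCoeff_eq, hord]

theorem HahnSeries.isNilpotent_single {Γ R : Type*} [AddCommMonoid Γ] [PartialOrder Γ]
    [IsOrderedCancelAddMonoid Γ] [CommRing R] (a : Γ) {r : R} (hr : IsNilpotent r) :
    IsNilpotent (HahnSeries.single a r) := by
  obtain ⟨k, hk⟩ := hr
  exact ⟨k, by rw [HahnSeries.single_pow, hk, HahnSeries.single_eq_zero]⟩

/-- A Laurent series with a unit coefficient below which all coefficients are nilpotent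
is a unit. -/
theorem LaurentSeries.isUnit_of_isNilpotent_coeff {R : Type*} [CommRing R] {f : LaurentSeries R}
    {n : ℤ} (hn : IsUnit (f.coeff n)) (hf : ∀ j < n, IsNilpotent (f.coeff j)) : IsUnit f := by
  suffices H : ∀ (k : ℕ) (f : LaurentSeries R), IsUnit (f.coeff n) →
      (∀ j < n, IsNilpotent (f.coeff j)) → (∀ j < n - k, f.coeff j = 0) → IsUnit f from
    H (n - f.order).toNat f hn hf fun j hj =>
      HahnSeries.coeff_eq_zero_of_lt_order (by omega)
  intro k
  induction k with
  | zero =>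
    intro f hn _ h0
    exact isUnit_of_coeff_eq_zero hn (by simpa using h0)
  | succ k ih =>
    intro f hn hf h0
    push_cast at h0
    set a : ℤ := n - (k + 1) with ha
    have hcoeff : ∀ j ≠ a, (f - HahnSeries.single a (f.coeff a)).coeff j = f.coeff j := by
      intro j hj
      simp [HahnSeries.coeff_single_of_ne hj]
    have hcoeff_self : (f - HahnSeries.single a (f.coeff a)).coeff a = 0 := by simp
    have hu : IsUnit (f - HahnSeries.single a (f.coeff a)) := by
      refine ih _ ?_ (fun j hj => ?_) fun j hj => ?_
      · rwa [hcoeff n (by omega)]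
      · by_cases hja : j = a
        · rw [hja, hcoeff_self]
          exact IsNilpotent.zero
        · rw [hcoeff j hja]
          exact hf j hj
      · by_cases hja : j = a
        · rw [hja, hcoeff_self]
        · rw [hcoeff j hja]
          exact h0 j (by omega)
    have hnil := HahnSeries.isNilpotent_single a (hf a (by omega))
    simpa using hnil.isUnit_add_left_of_commute hu (Commute.all _ _)

theorem stmt3 (R : Type) [CommRing R] (f : LaurentSeries R) :
    ((∃ n : ℤ, IsUnit (f.coeff n) ∧ ∀ j : ℤ, j < n → IsNilpotent (f.coeff j)) →
      IsUnit f) ∧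
    (∀ _ : IsDomain R, IsUnit f ↔ f ≠ 0 ∧ IsUnit (f.coeff f.order)) := by
  refine ⟨fun ⟨_, hn, hf⟩ => LaurentSeries.isUnit_of_isNilpotent_coeff hn hf, fun _ => ?_⟩
  rw [← HahnSeries.leadingCoeff_eq, ← HahnSeries.isUnit_iff]
  exact ⟨fun h => ⟨h.ne_zero, h⟩, And.right⟩
end

section
/- Let k be a field with char k ≠ 2, let F = k((t)), O = k[[t]], and let γ ∈ M₂(F) be the diagonal matrix diag(t, −t) acting on F². Then an O-lattice Λ in F² with [Λ : O²] = 0 satisfies γΛ ⊆ Λ if and only if there exists n ∈ ℤ such that tⁿO ⊕ t^{1−n}O ⊆ Λ ⊆ t^{n−1}O ⊕ t^{−n}O. (Thus the affine Springer fiber of γ for SL₂ is an infinite chain of ℙ¹'s.) -/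
open PowerSeries LaurentSeries

/-- The `k[[t]]`-submodule `t^a · k[[t]]` of the Laurent series field `k((t))`. -/
noncomputable def tO (k : Type) [Field k] (a : ℤ) :
    Submodule (PowerSeries k) (LaurentSeries k) :=
  Submodule.span (PowerSeries k) {(HahnSeries.single a 1 : LaurentSeries k)}

/-- The lattice `t^{a 0} O ⊕ ⋯ ⊕ t^{a (n-1)} O` in `F^n`. -/
noncomputable def diagLat (k : Type) [Field k] {n : ℕ} (a : Fin n → ℤ) :
    Submodule (PowerSeries k) (Fin n → LaurentSeries k) :=
  Submodule.pi Set.univ fun i => tO k (a i)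

/-- The standard lattice `O^n`. -/
noncomputable def stdLat (k : Type) [Field k] (n : ℕ) :
    Submodule (PowerSeries k) (Fin n → LaurentSeries k) :=
  diagLat k fun _ : Fin n => 0

/-- An `O = k[[t]]`-lattice in `F^n = k((t))^n`: a finitely generated `O`-submodule
spanning `F^n` over `F`. -/
def IsLattice {k : Type} [Field k] {n : ℕ}
    (Λ : Submodule (PowerSeries k) (Fin n → LaurentSeries k)) : Prop :=
  Λ.FG ∧ Submodule.span (LaurentSeries k) (Λ : Set (Fin n → LaurentSeries k)) = ⊤

/-- The `k`-dimension of `N/(N ⊓ P)`. -/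
noncomputable def qdim {k : Type} [Field k] {V : Type} [AddCommGroup V]
    [Module (PowerSeries k) V] (N P : Submodule (PowerSeries k) V) : ℕ :=
  letI := Module.compHom (↥N ⧸ Submodule.comap N.subtype (N ⊓ P))
    (algebraMap k (PowerSeries k))
  Module.finrank k (↥N ⧸ Submodule.comap N.subtype (N ⊓ P))

/-- The relative length `[Λ₁ : Λ₂] = dim_k Λ₁/(Λ₁∩Λ₂) − dim_k Λ₂/(Λ₁∩Λ₂)`. -/
noncomputable def relIdx {k : Type} [Field k] {V : Type} [AddCommGroup V]
    [Module (PowerSeries k) V] (A B : Submodule (PowerSeries k) V) : ℤ :=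
  (qdim A B : ℤ) - (qdim B A : ℤ)

section LaurentLattices

variable {k : Type} [Field k]

theorem powerSeries_smul_laurentSeries (p : PowerSeries k) (x : LaurentSeries k) :
    p • x = HahnSeries.ofPowerSeries ℤ k p * x := by
  rw [Algebra.smul_def, LaurentSeries.coe_algebraMap]

instance isScalarTower_powerSeries_laurentSeries :
    IsScalarTower k (PowerSeries k) (LaurentSeries k) :=
  ⟨fun c p x => by
    rw [powerSeries_smul_laurentSeries, powerSeries_smul_laurentSeries, PowerSeries.coe_smul,
      ← HahnSeries.C_mul_eq_smul, ← HahnSeries.C_mul_eq_smul, mul_assoc]⟩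

theorem coeff_ofPowerSeries_of_neg (p : PowerSeries k) {j : ℤ} (hj : j < 0) :
    (HahnSeries.ofPowerSeries ℤ k p).coeff j = 0 := by
  rw [PowerSeries.coeff_coe, if_pos hj]

theorem mem_tO_iff {a : ℤ} {x : LaurentSeries k} :
    x ∈ tO k a ↔ ∀ j < a, x.coeff j = 0 := by
  rw [tO, Submodule.mem_span_singleton]
  constructor
  · rintro ⟨p, rfl⟩ j hj
    rw [powerSeries_smul_laurentSeries, HahnSeries.coeff_mul_single,
      coeff_ofPowerSeries_of_neg p (by omega), zero_mul]
  · intro h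
    refine ⟨PowerSeries.mk fun n => x.coeff (a + n), ?_⟩
    ext j
    rw [powerSeries_smul_laurentSeries, HahnSeries.coeff_mul_single, mul_one]
    rcases lt_or_ge j a with hj | hj
    · rw [coeff_ofPowerSeries_of_neg _ (by omega), h j hj]
    · obtain ⟨n, hn⟩ := Int.eq_ofNat_of_zero_le (sub_nonneg.2 hj)
      rw [hn, LaurentSeries.coeff_coe_powerSeries, PowerSeries.coeff_mk]
      congr 1
      omega

theorem single_mem_tO {a b : ℤ} (h : a ≤ b) (c : k) :
    (HahnSeries.single b c : LaurentSeries k) ∈ tO k a :=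
  mem_tO_iff.2 fun _ hj => HahnSeries.coeff_single_of_ne (by omega)

theorem tO_le_tO_iff {a b : ℤ} : tO k a ≤ tO k b ↔ b ≤ a := by
  constructor
  · intro h
    by_contra! hab
    simpa using mem_tO_iff.1 (h (single_mem_tO le_rfl 1)) a hab
  · exact fun h x hx => mem_tO_iff.2 fun j hj => mem_tO_iff.1 hx j (by omega)

theorem single_mul_mem_tO {a b : ℤ} {x : LaurentSeries k} (hx : x ∈ tO k a) (c : k) :
    HahnSeries.single b c * x ∈ tO k (a + b) :=
  mem_tO_iff.2 fun j hj => by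
    rw [HahnSeries.coeff_single_mul, mem_tO_iff.1 hx _ (by omega), mul_zero]

theorem tO_le_iff {a : ℤ} {L : Submodule (PowerSeries k) (LaurentSeries k)} :
    tO k a ≤ L ↔ (HahnSeries.single a 1 : LaurentSeries k) ∈ L := by
  rw [tO, Submodule.span_singleton_le_iff_mem]

theorem mem_tO_order (x : LaurentSeries k) : x ∈ tO k x.order :=
  mem_tO_iff.2 fun _ hj => HahnSeries.coeff_eq_zero_of_lt_order hj

theorem single_order_mem {L : Submodule (PowerSeries k) (LaurentSeries k)} {x : LaurentSeries k}
    (hx : x ∈ L) (h0 : x ≠ 0) : (HahnSeries.single x.order 1 : LaurentSeries k) ∈ L := by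
  have hu : IsUnit x.powerSeriesPart := by
    rw [PowerSeries.isUnit_iff_constantCoeff, isUnit_iff_ne_zero,
      ← PowerSeries.coeff_zero_eq_constantCoeff_apply, LaurentSeries.powerSeriesPart_coeff]
    simpa using h0
  obtain ⟨u, hu⟩ := hu
  have h : (HahnSeries.single x.order 1 : LaurentSeries k) =
      ((u⁻¹ : (PowerSeries k)ˣ) : PowerSeries k) • x := by
    conv_rhs => rw [← LaurentSeries.single_order_mul_powerSeriesPart x]
    rw [mul_comm, ← powerSeries_smul_laurentSeries, ← hu, smul_smul, Units.inv_mul, one_smul]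
  rw [h]
  exact L.smul_mem _ hx

theorem exists_eq_tO {L : Submodule (PowerSeries k) (LaurentSeries k)} {M N : ℤ}
    (hM : L ≤ tO k M) (hN : tO k N ≤ L) : ∃ a, L = tO k a ∧ M ≤ a ∧ a ≤ N := by
  obtain ⟨a, ha, hmin⟩ := Int.exists_least_of_bdd (P := fun a => tO k a ≤ L)
    ⟨M, fun z hz => tO_le_tO_iff.1 (hz.trans hM)⟩ ⟨N, hN⟩
  refine ⟨a, le_antisymm (fun x hx => ?_) ha, tO_le_tO_iff.1 (ha.trans hM), hmin _ hN⟩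
  by_cases h0 : x = 0
  · rw [h0]
    exact zero_mem _
  · exact tO_le_tO_iff.2 (hmin _ (tO_le_iff.2 (single_order_mem hx h0))) (mem_tO_order x)

theorem mem_diagLat_iff {n : ℕ} {a : Fin n → ℤ} {v : Fin n → LaurentSeries k} :
    v ∈ diagLat k a ↔ ∀ i, v i ∈ tO k (a i) := by
  simp [diagLat, Submodule.mem_pi]

theorem exists_le_diagLat {n : ℕ} {Λ : Submodule (PowerSeries k) (Fin n → LaurentSeries k)}
    (h : Λ.FG) : ∃ M : ℤ, Λ ≤ diagLat k fun _ => M := by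
  obtain ⟨S, rfl⟩ := h
  obtain ⟨M, hM⟩ := Finset.exists_le (S.biUnion fun v => Finset.univ.image fun i => -(v i).order)
  refine ⟨-M, Submodule.span_le.2 fun v hv => mem_diagLat_iff.2 fun i => ?_⟩
  refine tO_le_tO_iff.2 (neg_le.1 (hM _ ?_)) (mem_tO_order (v i))
  simp only [Finset.mem_biUnion, Finset.mem_image, Finset.mem_univ, true_and]
  exact ⟨v, hv, i, rfl⟩

theorem single_smul_mem_of_le {n : ℕ} {Λ : Submodule (PowerSeries k) (Fin n → LaurentSeries k)}
    {v : Fin n → LaurentSeries k} {a b : ℤ} (hab : a ≤ b)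
    (hv : (HahnSeries.single a 1 : LaurentSeries k) • v ∈ Λ) :
    (HahnSeries.single b 1 : LaurentSeries k) • v ∈ Λ := by
  obtain ⟨p, hp⟩ := Submodule.mem_span_singleton.1 (single_mem_tO (k := k) hab 1)
  rw [← hp, smul_assoc]
  exact Λ.smul_mem _ hv

theorem exists_single_smul_mem {n : ℕ}
    {Λ : Submodule (PowerSeries k) (Fin n → LaurentSeries k)}
    (h : Submodule.span (LaurentSeries k) (Λ : Set (Fin n → LaurentSeries k)) = ⊤)
    (v : Fin n → LaurentSeries k) :
    ∃ N : ℤ, (HahnSeries.single N 1 : LaurentSeries k) • v ∈ Λ := by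
  have hv : v ∈ Submodule.span (LaurentSeries k) (Λ : Set (Fin n → LaurentSeries k)) :=
    h ▸ Submodule.mem_top
  induction hv using Submodule.span_induction with
  | mem x hx => exact ⟨0, by simpa using hx⟩
  | zero => exact ⟨0, by simp⟩
  | add x y _ _ hx hy =>
    obtain ⟨a, ha⟩ := hx
    obtain ⟨b, hb⟩ := hy
    refine ⟨max a b, ?_⟩
    rw [smul_add]
    exact Λ.add_mem (single_smul_mem_of_le (le_max_left a b) ha)
      (single_smul_mem_of_le (le_max_right a b) hb)
  | smul c x _ hx =>
    obtain ⟨a, ha⟩ := hx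
    refine ⟨a - c.order, ?_⟩
    obtain ⟨p, hp⟩ := Submodule.mem_span_singleton.1
      (single_mul_mem_tO (b := a - c.order) (mem_tO_order c) 1)
    rw [smul_smul, ← hp, show c.order + (a - c.order) = a by omega, smul_assoc]
    exact Λ.smul_mem _ ha

theorem exists_diagLat_le {n : ℕ} {Λ : Submodule (PowerSeries k) (Fin n → LaurentSeries k)}
    (h : Submodule.span (LaurentSeries k) (Λ : Set (Fin n → LaurentSeries k)) = ⊤) :
    ∃ N : ℤ, (diagLat k fun _ => N) ≤ Λ := by
  choose N hN using fun i => exists_single_smul_mem h (Pi.single i 1)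
  obtain ⟨M, hM⟩ := Finset.exists_le (Finset.univ.image N)
  refine ⟨M, fun v hv => ?_⟩
  rw [← Finset.univ_sum_single v]
  refine Λ.sum_mem fun i _ => ?_
  have hi : N i ≤ M := hM _ (Finset.mem_image_of_mem _ (Finset.mem_univ i))
  obtain ⟨p, hp⟩ := Submodule.mem_span_singleton.1 (tO_le_tO_iff.2 hi (mem_diagLat_iff.1 hv i))
  have : Pi.single i (v i) = p • (HahnSeries.single (N i) 1 : LaurentSeries k) •
      (Pi.single i 1 : Fin n → LaurentSeries k) := by
    rw [← smul_assoc, hp, ← Pi.single_smul, smul_eq_mul, mul_one]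
  rw [this]
  exact Λ.smul_mem _ (hN i)

theorem qdim_eq_finrank {V : Type} [AddCommGroup V] [Module (PowerSeries k) V] [Module k V]
    [IsScalarTower k (PowerSeries k) V] (N P : Submodule (PowerSeries k) V) :
    qdim N P = Module.finrank k (N ⧸ Submodule.comap N.subtype (N ⊓ P)) := by
  unfold qdim
  congr 1
  refine Module.ext' _ _ fun r m => ?_
  exact algebraMap_smul (PowerSeries k) r m

theorem qdim_add_finrank_map {V W : Type} [AddCommGroup V] [Module (PowerSeries k) V] [Module k V]
    [IsScalarTower k (PowerSeries k) V] [AddCommGroup W] [Module k W] (f : V →ₗ[k] W)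
    (N P : Submodule (PowerSeries k) V)
    (hf : LinearMap.ker f ≤ (N ⊓ P).restrictScalars k)
    [FiniteDimensional k ((N.restrictScalars k).map f)] :
    qdim N P + Module.finrank k (((N ⊓ P).restrictScalars k).map f) =
      Module.finrank k ((N.restrictScalars k).map f) := by
  set A := (N.restrictScalars k).map f
  set B := ((N ⊓ P).restrictScalars k).map f
  have hBA : B ≤ A := Submodule.map_mono fun x hx => hx.1
  let g : N.restrictScalars k →ₗ[k] A :=
    f.restrict fun x hx => Submodule.mem_map_of_mem hx
  have hg : Function.Surjective g := by
    rintro ⟨_, x, hx, rfl⟩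
    exact ⟨⟨x, hx⟩, rfl⟩
  let q := (B.submoduleOf A).mkQ ∘ₗ g
  have hq : Function.Surjective q := (Submodule.mkQ_surjective _).comp hg
  have hker : LinearMap.ker q = (Submodule.comap N.subtype (N ⊓ P)).restrictScalars k := by
    ext ⟨x, hx⟩
    simp only [q, LinearMap.ker_comp, Submodule.ker_mkQ, Submodule.mem_comap]
    change f x ∈ B ↔ x ∈ N ⊓ P
    refine ⟨?_, fun h => Submodule.mem_map_of_mem h⟩
    rintro ⟨y, hy, hxy⟩
    have := hf (show x - y ∈ LinearMap.ker f by simp [hxy])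
    simpa using Submodule.add_mem _ this hy
  have e := q.quotKerEquivOfSurjective hq
  rw [hker] at e
  have e' : (N ⧸ Submodule.comap N.subtype (N ⊓ P)) ≃ₗ[k] A ⧸ B.submoduleOf A := e
  rw [qdim_eq_finrank, e'.finrank_eq, ← (Submodule.submoduleOfEquivOfLe hBA).finrank_eq,
    Submodule.finrank_quotient_add_finrank]

theorem relIdx_eq_finrank_sub {V W : Type} [AddCommGroup V] [Module (PowerSeries k) V] [Module k V]
    [IsScalarTower k (PowerSeries k) V] [AddCommGroup W] [Module k W] (f : V →ₗ[k] W)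
    (N P : Submodule (PowerSeries k) V)
    (hN : LinearMap.ker f ≤ N.restrictScalars k) (hP : LinearMap.ker f ≤ P.restrictScalars k)
    [FiniteDimensional k ((N.restrictScalars k).map f)]
    [FiniteDimensional k ((P.restrictScalars k).map f)] :
    relIdx N P = Module.finrank k ((N.restrictScalars k).map f) -
      Module.finrank k ((P.restrictScalars k).map f) := by
  have h1 := qdim_add_finrank_map f N P fun x hx => ⟨hN hx, hP hx⟩
  have h2 := qdim_add_finrank_map f P N fun x hx => ⟨hP hx, hN hx⟩
  rw [inf_comm P N] at h2
  rw [relIdx]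
  omega

/-- The truncation `F → F` modulo `t^N O`, which keeps the coefficients of index below `N`. -/
noncomputable def laurentTrunc (k : Type) [Field k] (N : ℤ) :
    LaurentSeries k →ₗ[k] LaurentSeries k :=
  HahnSeries.truncLTLinearMap k N

theorem coeff_laurentTrunc (N j : ℤ) (x : LaurentSeries k) :
    (laurentTrunc k N x).coeff j = if j < N then x.coeff j else 0 :=
  HahnSeries.coeff_truncLT N x j

theorem laurentTrunc_eq_zero_iff {N : ℤ} {x : LaurentSeries k} :
    laurentTrunc k N x = 0 ↔ x ∈ tO k N := by
  rw [mem_tO_iff]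
  constructor
  · intro h j hj
    have := coeff_laurentTrunc N j x
    rwa [h, if_pos hj, HahnSeries.coeff_zero, eq_comm] at this
  · intro h
    ext j
    rw [coeff_laurentTrunc]
    split_ifs with hj
    · simpa using h j hj
    · simp

/-- The image of `t^a O` under truncation below `N` has coordinates indexed by `[a, N)`. -/
theorem nonempty_map_laurentTrunc_equiv (a N : ℤ) :
    Nonempty ((((tO k a).restrictScalars k).map (laurentTrunc k N)) ≃ₗ[k]
      (Fin (N - a).toNat → k)) := by
  let ρ : (((tO k a).restrictScalars k).map (laurentTrunc k N)) →ₗ[k] (Fin (N - a).toNat → k) :=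
    { toFun := fun x i => (x : LaurentSeries k).coeff (a + (i : ℕ))
      map_add' := fun x y => rfl
      map_smul' := fun c x => rfl }
  refine ⟨LinearEquiv.ofBijective ρ ⟨?_, fun c => ?_⟩⟩
  · rw [injective_iff_map_eq_zero]
    rintro ⟨_, x, hx, rfl⟩ h
    rw [Subtype.ext_iff]
    ext j
    change (laurentTrunc k N x).coeff j = 0
    have hx' := mem_tO_iff.1 hx
    by_cases hj : a ≤ j ∧ j < N
    · have := congrFun h ⟨(j - a).toNat, by omega⟩
      simpa [ρ, Int.toNat_of_nonneg (sub_nonneg.2 hj.1)] using this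
    · rw [coeff_laurentTrunc]
      split_ifs with hjN
      · exact hx' j (by omega)
      · rfl
  · let y : LaurentSeries k := ∑ i : Fin (N - a).toNat, HahnSeries.single (a + (i : ℕ)) (c i)
    have hy : y ∈ tO k a := Submodule.sum_mem _ fun i _ => single_mem_tO (by omega) _
    refine ⟨⟨_, Submodule.mem_map_of_mem (show y ∈ (tO k a).restrictScalars k from hy)⟩, ?_⟩
    ext i
    change (laurentTrunc k N y).coeff (a + (i : ℕ)) = c i
    rw [coeff_laurentTrunc, if_pos (by omega)]
    simp only [y, HahnSeries.coeff_sum]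
    rw [Finset.sum_eq_single i]
    · exact HahnSeries.coeff_single_same _ _
    · intro j _ hj
      refine HahnSeries.coeff_single_of_ne fun h => hj (Fin.ext ?_)
      omega
    · simp

instance finiteDimensional_map_laurentTrunc (a N : ℤ) :
    FiniteDimensional k (((tO k a).restrictScalars k).map (laurentTrunc k N)) :=
  (nonempty_map_laurentTrunc_equiv a N).elim fun e => Module.Finite.equiv e.symm

theorem finrank_map_laurentTrunc {a N : ℤ} (h : a ≤ N) :
    (Module.finrank k (((tO k a).restrictScalars k).map (laurentTrunc k N)) : ℤ) = N - a := by
  obtain ⟨e⟩ := nonempty_map_laurentTrunc_equiv (k := k) a N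
  rw [e.finrank_eq, Module.finrank_fin_fun, Int.toNat_of_nonneg (sub_nonneg.2 h)]

theorem ker_compLeft_laurentTrunc (n : ℕ) (N : ℤ) :
    LinearMap.ker ((laurentTrunc k N).compLeft (Fin n)) =
      (diagLat k fun _ => N).restrictScalars k := by
  ext v
  rw [LinearMap.mem_ker, Submodule.restrictScalars_mem, mem_diagLat_iff, funext_iff]
  exact forall_congr' fun i => laurentTrunc_eq_zero_iff

theorem finiteDimensional_map_compLeft_laurentTrunc {n : ℕ}
    {Λ : Submodule (PowerSeries k) (Fin n → LaurentSeries k)} {M : ℤ} (N : ℤ)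
    (hM : Λ ≤ diagLat k fun _ => M) :
    FiniteDimensional k ((Λ.restrictScalars k).map ((laurentTrunc k N).compLeft (Fin n))) := by
  set S := (Λ.restrictScalars k).map ((laurentTrunc k N).compLeft (Fin n))
  have hS : ∀ v ∈ S, ∀ i, v i ∈ ((tO k M).restrictScalars k).map (laurentTrunc k N) := by
    rintro _ ⟨v, hv, rfl⟩ i
    exact Submodule.mem_map_of_mem (mem_diagLat_iff.1 (hM hv) i)
  let g : S →ₗ[k] Fin n → ((tO k M).restrictScalars k).map (laurentTrunc k N) :=
    LinearMap.pi fun i => (LinearMap.proj i ∘ₗ S.subtype).codRestrict _ fun v => hS v v.2 i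
  refine Module.Finite.of_injective g fun v w h => Subtype.ext (funext fun i => ?_)
  exact congrArg Subtype.val (congrFun h i)

theorem finrank_map_compLeft_laurentTrunc
    {Λ : Submodule (PowerSeries k) (Fin 2 → LaurentSeries k)} {M N a d : ℤ}
    (hM : Λ ≤ diagLat k fun _ => M) (hN : (diagLat k fun _ => N) ≤ Λ)
    (ha : ∀ x, ![x, 0] ∈ Λ ↔ x ∈ tO k a) (hd : Λ.map (LinearMap.proj 1) = tO k d)
    (haN : a ≤ N) (hdN : d ≤ N) :
    (Module.finrank k ((Λ.restrictScalars k).map ((laurentTrunc k N).compLeft (Fin 2))) : ℤ) =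
      (N - a) + (N - d) := by
  have := finiteDimensional_map_compLeft_laurentTrunc N hM
  set S := (Λ.restrictScalars k).map ((laurentTrunc k N).compLeft (Fin 2))
  let g : S →ₗ[k] LaurentSeries k := LinearMap.proj 1 ∘ₗ S.subtype
  have hrange : LinearMap.range g = ((tO k d).restrictScalars k).map (laurentTrunc k N) := by
    rw [← hd]
    ext x
    constructor
    · rintro ⟨⟨_, v, hv, rfl⟩, rfl⟩
      exact ⟨v 1, ⟨v, hv, rfl⟩, rfl⟩
    · rintro ⟨_, ⟨v, hv, rfl⟩, rfl⟩
      exact ⟨⟨_, v, hv, rfl⟩, rfl⟩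
  have hker : (LinearMap.ker g).map S.subtype =
      (((tO k a).restrictScalars k).map (laurentTrunc k N)).map
        (LinearMap.single k (fun _ : Fin 2 => LaurentSeries k) 0) := by
    ext w
    constructor
    · rintro ⟨⟨_, v, hv, rfl⟩, hw, rfl⟩
      have hv1 : laurentTrunc k N (v 1) = 0 := hw
      have h1 : ![0, v 1] ∈ Λ := hN <| mem_diagLat_iff.2 <| Fin.forall_fin_two.2
        ⟨zero_mem _, laurentTrunc_eq_zero_iff.1 hv1⟩
      have h0 : ![v 0, 0] ∈ Λ := by
        convert Λ.sub_mem hv h1 using 1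
        ext i : 1
        fin_cases i <;> simp
      refine ⟨_, ⟨v 0, (ha _).1 h0, rfl⟩, ?_⟩
      ext i : 1
      fin_cases i
      · simp
      · simpa using hv1.symm
    · rintro ⟨_, ⟨x, hx, rfl⟩, rfl⟩
      refine ⟨⟨_, ![x, 0], (ha x).2 hx, rfl⟩, ?_, ?_⟩
      · change laurentTrunc k N 0 = 0
        exact map_zero _
      · ext i : 1
        fin_cases i <;> simp
  have h1 := g.finrank_range_add_finrank_ker
  have h2 : Module.finrank k (LinearMap.ker g) =
      Module.finrank k (((tO k a).restrictScalars k).map (laurentTrunc k N)) := by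
    rw [(Submodule.equivMapOfInjective S.subtype S.injective_subtype (LinearMap.ker g)).finrank_eq,
      hker]
    exact (Submodule.equivMapOfInjective _
      (Pi.single_injective (M := fun _ : Fin 2 => LaurentSeries k) 0) _).finrank_eq.symm
  rw [← h1, hrange, h2]
  push_cast
  rw [finrank_map_laurentTrunc haN, finrank_map_laurentTrunc hdN]
  ring

theorem vecCons_mem_stdLat_iff {x : LaurentSeries k} : ![x, 0] ∈ stdLat k 2 ↔ x ∈ tO k 0 := by
  rw [stdLat, mem_diagLat_iff, Fin.forall_fin_two]
  exact and_iff_left (zero_mem _)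

theorem map_proj_one_stdLat : (stdLat k 2).map (LinearMap.proj 1) = tO k 0 := by
  ext x
  constructor
  · rintro ⟨v, hv, rfl⟩
    exact mem_diagLat_iff.1 hv 1
  · intro hx
    exact ⟨![0, x], mem_diagLat_iff.2 (Fin.forall_fin_two.2 ⟨zero_mem _, hx⟩), rfl⟩

/-- A lattice in `F²` is an extension of `t^d O` by `t^a O`, and its relative length to `O²` is
`-a - d`. -/
theorem IsLattice.exists_extension {Λ : Submodule (PowerSeries k) (Fin 2 → LaurentSeries k)}
    (hΛ : IsLattice Λ) :
    ∃ a d : ℤ, (∀ x, ![x, 0] ∈ Λ ↔ x ∈ tO k a) ∧ Λ.map (LinearMap.proj 1) = tO k d ∧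
      relIdx Λ (stdLat k 2) = -a - d := by
  obtain ⟨M, hM⟩ := exists_le_diagLat hΛ.1
  obtain ⟨N₀, hN₀⟩ := exists_diagLat_le hΛ.2
  obtain ⟨N, hNN₀, hN0⟩ : ∃ N : ℤ, N₀ ≤ N ∧ 0 ≤ N := ⟨max N₀ 0, le_max_left _ _, le_max_right _ _⟩
  have hN : (diagLat k fun _ => N) ≤ Λ := fun v hv => hN₀ <| mem_diagLat_iff.2 fun i =>
    tO_le_tO_iff.2 hNN₀ (mem_diagLat_iff.1 hv i)
  have hN' : (diagLat k fun _ => N) ≤ stdLat k 2 := fun v hv => mem_diagLat_iff.2 fun i =>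
    tO_le_tO_iff.2 hN0 (mem_diagLat_iff.1 hv i)
  have hsingle : ∀ x : LaurentSeries k, Pi.single 0 x = ![x, 0] := fun x => by
    ext i : 1
    fin_cases i <;> simp
  obtain ⟨a, ha, -, haN⟩ := exists_eq_tO (M := M) (N := N)
    (L := Λ.comap (LinearMap.single (PowerSeries k) (fun _ : Fin 2 => LaurentSeries k) 0))
    (fun x hx => by simpa using mem_diagLat_iff.1 (hM hx) 0)
    (fun x hx => hN <| mem_diagLat_iff.2 <| by
      rw [LinearMap.single_apply, hsingle]
      exact Fin.forall_fin_two.2 ⟨hx, zero_mem _⟩)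
  obtain ⟨d, hd, -, hdN⟩ := exists_eq_tO (M := M) (N := N) (L := Λ.map (LinearMap.proj 1))
    (by
      rintro _ ⟨v, hv, rfl⟩
      exact mem_diagLat_iff.1 (hM hv) 1)
    (fun x hx => ⟨![0, x], hN <| mem_diagLat_iff.2 <| Fin.forall_fin_two.2 ⟨zero_mem _, hx⟩, rfl⟩)
  have ha' : ∀ x, ![x, 0] ∈ Λ ↔ x ∈ tO k a := fun x => by
    rw [← ha, Submodule.mem_comap, LinearMap.single_apply, hsingle]
  refine ⟨a, d, ha', hd, ?_⟩
  have := finiteDimensional_map_compLeft_laurentTrunc N hM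
  have := finiteDimensional_map_compLeft_laurentTrunc (k := k) N (le_refl (stdLat k 2))
  have hker := ker_compLeft_laurentTrunc (k := k) 2 N
  rw [relIdx_eq_finrank_sub ((laurentTrunc k N).compLeft (Fin 2)) Λ (stdLat k 2)
      (hker.le.trans fun _ h => hN h) (hker.le.trans fun _ h => hN' h),
    finrank_map_compLeft_laurentTrunc hM hN ha' hd haN hdN,
    finrank_map_compLeft_laurentTrunc (le_refl (stdLat k 2)) hN'
      (fun _ => vecCons_mem_stdLat_iff) map_proj_one_stdLat hN0 hN0]
  ring

theorem diagonal_mulVec_fin_two (v : Fin 2 → LaurentSeries k) :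
    (Matrix.diagonal ![HahnSeries.single 1 1, -HahnSeries.single 1 1]).mulVec v =
      ![HahnSeries.single 1 1 * v 0, -(HahnSeries.single 1 1 * v 1)] := by
  ext i : 1
  fin_cases i <;> simp [Matrix.mulVec_diagonal]

end LaurentLattices

theorem stmt5 (k : Type) [Field k] (hchar : (2 : k) ≠ 0)
    (γ : Matrix (Fin 2) (Fin 2) (LaurentSeries k))
    (hγ : γ = Matrix.diagonal ![HahnSeries.single 1 1, -HahnSeries.single 1 1])
    (Λ : Submodule (PowerSeries k) (Fin 2 → LaurentSeries k))
    (hΛ : IsLattice Λ) (h0 : relIdx Λ (stdLat k 2) = 0) :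
    (∀ v ∈ Λ, γ.mulVec v ∈ Λ) ↔
      ∃ n : ℤ, diagLat k ![n, 1 - n] ≤ Λ ∧ Λ ≤ diagLat k ![n - 1, -n] := by
  subst hγ
  simp only [diagonal_mulVec_fin_two]
  constructor
  · intro hstab
    obtain ⟨a, d, ha, hd, hidx⟩ := hΛ.exists_extension
    obtain rfl : d = -a := by omega
    have hmem : ∀ v ∈ Λ, ![HahnSeries.single 1 1 * v 0, 0] ∈ Λ ∧
        ![0, HahnSeries.single 1 1 * v 1] ∈ Λ := by
      intro v hv
      have htv : (![HahnSeries.single 1 1 * v 0, HahnSeries.single 1 1 * v 1] :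
          Fin 2 → LaurentSeries k) ∈ Λ := by
        convert Λ.smul_mem PowerSeries.X hv using 1
        ext i : 1
        fin_cases i <;> simp [powerSeries_smul_laurentSeries]
      have hhalf : ∀ x : LaurentSeries k, (2⁻¹ : k) • (x + x) = x := fun x => by
        rw [← two_smul k x, smul_smul, inv_mul_cancel₀ hchar, one_smul]
      have hadd := (Λ.restrictScalars k).smul_mem 2⁻¹ (Λ.add_mem htv (hstab v hv))
      have hsub := (Λ.restrictScalars k).smul_mem 2⁻¹ (Λ.sub_mem htv (hstab v hv))
      simp only [Submodule.restrictScalars_mem] at hadd hsub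
      constructor
      · convert hadd using 1
        ext i : 1
        fin_cases i <;> simp [hhalf, -smul_add]
      · convert hsub using 1
        ext i : 1
        fin_cases i <;> simp [hhalf, -smul_add]
    refine ⟨a, fun v hv => ?_, fun v hv => ?_⟩
    · rw [mem_diagLat_iff, Fin.forall_fin_two] at hv
      have h1 : HahnSeries.single (-1) 1 * v 1 ∈ tO k (-a) := by
        have := single_mul_mem_tO (b := -1) hv.2 1
        rwa [show (![a, 1 - a] : Fin 2 → ℤ) 1 + -1 = -a by simp; ring] at this
      rw [← hd] at h1
      obtain ⟨w, hw, hw1 : w 1 = _⟩ := h1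
      have h2 := (hmem w hw).2
      rw [hw1, ← mul_assoc, HahnSeries.single_mul_single] at h2
      convert Λ.add_mem ((ha (v 0)).2 hv.1) h2 using 1
      ext i : 1
      fin_cases i <;> simp
    · rw [mem_diagLat_iff, Fin.forall_fin_two]
      constructor
      · have := single_mul_mem_tO (b := -1) ((ha _).1 (hmem v hv).1) 1
        rw [← mul_assoc, HahnSeries.single_mul_single] at this
        simpa [sub_eq_add_neg] using this
      · change v 1 ∈ tO k (-a)
        rw [← hd]
        exact ⟨v, hv, rfl⟩
  · rintro ⟨n, hle, hge⟩ v hv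
    have h := mem_diagLat_iff.1 (hge hv)
    rw [Fin.forall_fin_two] at h
    refine hle (mem_diagLat_iff.2 (Fin.forall_fin_two.2 ⟨?_, ?_⟩))
    · simpa using single_mul_mem_tO (b := 1) h.1 1
    · simpa [add_comm, sub_eq_add_neg] using neg_mem (single_mul_mem_tO (b := 1) h.2 1)
end

section
/- Let k be a field and V = k⁴ with basis v₁, v₂, v₃, v₄, equipped with the symplectic form ω determined by ω(v₁,v₄) = ω(v₂,v₃) = 1 and ω(vᵢ,vⱼ) = 0 for i < j with i + j ≠ 5. Let e ∈ End(V) be given by e(v₄) = v₁ and e(v₁) = e(v₂) = e(v₃) = 0 (a nilpotent element of sp(V,ω)). Let V₁ ⊂ V₂ be subspaces of V with dim V₁ = 1, dim V₂ = 2, V₂ Lagrangian (ω vanishes identically on V₂ × V₂), and set V₃ = V₁^⊥ (the ω-orthogonal complement of V₁). Then the conditions e·V₁ = 0, e·V₂ ⊆ V₁, e·V₃ ⊆ V₂ and e·V ⊆ V₃ hold if and only if span{v₁} ⊆ V₂ ⊆ span{v₁, v₂, v₃}. -/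
theorem stmt9 (k : Type) [Field k]
    (ω : LinearMap.BilinForm k (Fin 4 → k))
    (hω : ω = Matrix.toLinearMap₂' k (Matrix.of
      ![![0, 0, 0, 1], ![0, 0, 1, 0], ![0, -1, 0, 0], ![-1, 0, 0, 0]]))
    (e : (Fin 4 → k) →ₗ[k] (Fin 4 → k))
    (he : e = Matrix.mulVecLin (Matrix.of
      ![![0, 0, 0, 1], ![0, 0, 0, 0], ![0, 0, 0, 0], ![0, 0, 0, 0]]))
    (V₁ V₂ : Submodule k (Fin 4 → k)) (h12 : V₁ ≤ V₂)
    (hd1 : Module.finrank k V₁ = 1) (hd2 : Module.finrank k V₂ = 2)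
    (hLag : ∀ u ∈ V₂, ∀ w ∈ V₂, ω u w = 0)
    (V₃ : Submodule k (Fin 4 → k)) (hV₃ : V₃ = ω.orthogonal V₁) :
    (V₁ ≤ LinearMap.ker e ∧ Submodule.map e V₂ ≤ V₁ ∧
      Submodule.map e V₃ ≤ V₂ ∧ LinearMap.range e ≤ V₃) ↔
    (Submodule.span k {Pi.single (0 : Fin 4) (1 : k)} ≤ V₂ ∧
      V₂ ≤ Submodule.span k {Pi.single (0 : Fin 4) (1 : k),
        Pi.single (1 : Fin 4) (1 : k), Pi.single (2 : Fin 4) (1 : k)}) := by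
  have hω_apply : ∀ u w, ω u w = u 0 * w 3 + u 1 * w 2 - u 2 * w 1 - u 3 * w 0 := by
    intro u w
    simp [hω, Matrix.toLinearMap₂'_apply', Matrix.mulVec, dotProduct, Fin.sum_univ_four]
    ring
  have he_apply : ∀ u, e u = u 3 • Pi.single (0 : Fin 4) (1 : k) := by
    intro u
    ext i
    fin_cases i <;> simp [he, Matrix.mulVec, dotProduct, Fin.sum_univ_four]
  have hrefl : ω.IsRefl := by
    intro u w h
    rw [hω_apply] at h ⊢
    linear_combination -h
  have hnondeg : ω.Nondegenerate := by
    refine (LinearMap.IsRefl.nondegenerate_iff_separatingLeft hrefl).2 ?_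
    intro u hu
    ext i
    have h0 := hu (Pi.single 0 1)
    have h1 := hu (Pi.single 1 1)
    have h2 := hu (Pi.single 2 1)
    have h3 := hu (Pi.single 3 1)
    simp [hω_apply] at h0 h1 h2 h3
    fin_cases i <;> simp [h0, h1, h2, h3]
  have hV₂_orth : V₂ = ω.orthogonal V₂ := by
    refine Submodule.eq_of_le_of_finrank_eq (fun w hw u hu => hLag u hu w hw) ?_
    rw [LinearMap.BilinForm.finrank_orthogonal hnondeg, hd2]
    simp
  have hmem_span : ∀ u : Fin 4 → k, u ∈ Submodule.span k {Pi.single (0 : Fin 4) (1 : k),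
      Pi.single (1 : Fin 4) (1 : k), Pi.single (2 : Fin 4) (1 : k)} ↔ u 3 = 0 := by
    intro u
    rw [Submodule.mem_span_triple]
    constructor
    · rintro ⟨a, b, c, rfl⟩
      simp
    · intro h
      refine ⟨u 0, u 1, u 2, ?_⟩
      ext i
      fin_cases i <;> simp [h]
  rw [Submodule.span_singleton_le_iff_mem]
  constructor
  · rintro ⟨-, hmap, -, -⟩
    have hlast : ∀ u ∈ V₂, u 3 = 0 := by
      intro u hu
      by_contra hne
      have hmem := hmap (Submodule.mem_map_of_mem hu)
      rw [he_apply, Submodule.smul_mem_iff _ hne] at hmem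
      have h := hLag _ (h12 hmem) u hu
      simp [hω_apply] at h
      exact hne h
    refine ⟨?_, fun u hu => (hmem_span u).2 (hlast u hu)⟩
    rw [hV₂_orth]
    intro u hu
    simp [hω_apply, hlast u hu]
  · rintro ⟨hmem, hle⟩
    have hlast : ∀ u ∈ V₂, u 3 = 0 := fun u hu => (hmem_span u).1 (hle hu)
    refine ⟨fun u hu => ?_, ?_, ?_, ?_⟩
    · simp [he_apply, hlast u (h12 hu)]
    · rintro _ ⟨u, hu, rfl⟩
      simp [he_apply, hlast u hu]
    · rintro _ ⟨u, -, rfl⟩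
      rw [he_apply]
      exact V₂.smul_mem _ hmem
    · rintro _ ⟨u, rfl⟩
      rw [hV₃, he_apply]
      intro w hw
      simp [hω_apply, hlast w (h12 hw)]
end

section
/- Let k be a field, F = k((t)), O = k[[t]], and let γ ∈ M_n(F). Then there exists an O-lattice Λ in F^n with γΛ ⊆ Λ if and only if the characteristic polynomial of γ has all its coefficients in O. -/
open PowerSeries LaurentSeries

/-- The matrix of an endomorphism `f` of `V` stabilizing an `R`-lattice `M`, in a basis of `M`, is
the image of the matrix of the restriction of `f` to `M`. -/
theorem toMatrix_extendOfIsLattice {R K V ι : Type*} [CommRing R] [Field K] [Algebra R K]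
    [IsFractionRing R K] [AddCommGroup V] [Module K V] [Module R V] [IsScalarTower R K V]
    [Fintype ι] [DecidableEq ι] {M : Submodule R V} [Submodule.IsLattice K M]
    (b : Module.Basis ι R M) (f : V →ₗ[K] V) (hf : ∀ v ∈ M, f.restrictScalars R v ∈ M) :
    LinearMap.toMatrix (b.extendOfIsLattice K) (b.extendOfIsLattice K) f =
      (LinearMap.toMatrix b b ((f.restrictScalars R).restrict hf)).map (algebraMap R K) := by
  ext i j
  have h : f (b j : V) = ∑ l, algebraMap R K
      (LinearMap.toMatrix b b ((f.restrictScalars R).restrict hf) l j) •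
        b.extendOfIsLattice K l := by
    have hb := congrArg M.subtype (b.sum_repr ((f.restrictScalars R).restrict hf (b j)))
    rw [map_sum] at hb
    simpa [LinearMap.toMatrix_apply, -Module.Basis.sum_repr] using hb.symm
  rw [LinearMap.toMatrix_apply, Module.Basis.extendOfIsLattice_apply, h,
    Module.Basis.repr_sum_self, Matrix.map_apply]

/-- The characteristic polynomial of an endomorphism stabilizing a lattice over a principal ideal
domain has integral coefficients. -/
theorem charpoly_mem_lifts_of_stable_lattice {R K V : Type*} [CommRing R] [IsDomain R]
    [IsPrincipalIdealRing R] [Field K] [Algebra R K] [IsFractionRing R K] [AddCommGroup V]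
    [Module K V] [Module.Finite K V] [Module R V] [IsScalarTower R K V] (M : Submodule R V)
    [Submodule.IsLattice K M] (f : V →ₗ[K] V) (hf : ∀ v ∈ M, f v ∈ M) :
    f.charpoly ∈ Polynomial.lifts (algebraMap R K) := by
  classical
  have : Module.Free R M := Submodule.IsLattice.free K M
  have : Module.Finite R M := Submodule.IsLattice.finite K M
  let b := Module.Free.chooseBasis R M
  rw [← LinearMap.charpoly_toMatrix f (b.extendOfIsLattice K), toMatrix_extendOfIsLattice b f hf,
    Matrix.charpoly_map]
  exact (Polynomial.mem_lifts _).2 ⟨_, rfl⟩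

/-- A matrix whose characteristic polynomial lifts to `R` is integral over `R`. -/
theorem isIntegral_of_charpoly_mem_lifts {R K ι : Type*} [CommRing R] [CommRing K] [Algebra R K]
    [Fintype ι] [DecidableEq ι] (A : Matrix ι ι K)
    (h : A.charpoly ∈ Polynomial.lifts (algebraMap R K)) : IsIntegral R A := by
  obtain ⟨q, hq, -, hm⟩ := Polynomial.lifts_and_natDegree_eq_and_monic h A.charpoly_monic
  refine ⟨q, hm, ?_⟩
  rw [← Polynomial.aeval_def, ← Polynomial.aeval_map_algebraMap K, hq, A.aeval_self_charpoly]

/-- A matrix integral over `R` stabilizes a finitely generated `R`-submodule spanning `K^ι`. -/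
theorem exists_stable_lattice_of_isIntegral {R K ι : Type*} [CommRing R] [CommRing K]
    [Algebra R K] [Fintype ι] [DecidableEq ι] (A : Matrix ι ι K) (h : IsIntegral R A) :
    ∃ M : Submodule R (ι → K), M.FG ∧ Submodule.span K (M : Set (ι → K)) = ⊤ ∧
      ∀ v ∈ M, A.mulVec v ∈ M := by
  let e (i : ι) : Matrix ι ι K →ₗ[R] (ι → K) :=
    ((Matrix.mulVecBilin K K).flip (Pi.single i 1)).restrictScalars R
  let N := Subalgebra.toSubmodule (Algebra.adjoin R {A})
  refine ⟨⨆ i, N.map (e i), Submodule.fg_iSup _ fun i => h.fg_adjoin_singleton.map _, ?_, ?_⟩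
  · rw [eq_top_iff, ← (Pi.basisFun K ι).span_eq]
    refine Submodule.span_mono ?_
    rintro _ ⟨i, rfl⟩
    refine Submodule.mem_iSup_of_mem i ⟨1, one_mem (Algebra.adjoin R {A}), ?_⟩
    simp [e]
  · intro v hv
    induction hv using Submodule.iSup_induction' with
    | mem i v hv =>
      obtain ⟨B, hB, rfl⟩ := hv
      refine Submodule.mem_iSup_of_mem i
        ⟨A * B, (Algebra.adjoin R {A}).mul_mem (Algebra.self_mem_adjoin_singleton R A) hB, ?_⟩
      simp [e]
    | zero => simp
    | add v w _ _ hv hw => rw [Matrix.mulVec_add]; exact add_mem hv hw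

theorem stmt12 (k : Type) [Field k] (n : ℕ)
    (γ : Matrix (Fin n) (Fin n) (LaurentSeries k)) :
    (∃ Λ : Submodule (PowerSeries k) (Fin n → LaurentSeries k),
        IsLattice Λ ∧ ∀ v ∈ Λ, γ.mulVec v ∈ Λ) ↔
      ∀ i : ℕ, γ.charpoly.coeff i ∈
        (algebraMap (PowerSeries k) (LaurentSeries k)).range := by
  have lifts_iff : γ.charpoly ∈ Polynomial.lifts (algebraMap (PowerSeries k) (LaurentSeries k)) ↔
      ∀ i : ℕ, γ.charpoly.coeff i ∈
        (algebraMap (PowerSeries k) (LaurentSeries k)).range :=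
    Polynomial.lifts_iff_coeff_lifts _
  rw [← lifts_iff]
  constructor
  · rintro ⟨Λ, ⟨hfg, hspan⟩, hγ⟩
    have : Submodule.IsLattice (LaurentSeries k) Λ := ⟨hfg, hspan⟩
    rw [← Matrix.charpoly_toLin']
    exact charpoly_mem_lifts_of_stable_lattice Λ (Matrix.toLin' γ) hγ
  · intro h
    obtain ⟨Λ, hfg, hspan, hγ⟩ :=
      exists_stable_lattice_of_isIntegral γ (isIntegral_of_charpoly_mem_lifts γ h)
    exact ⟨Λ, ⟨hfg, hspan⟩, hγ⟩
end

section
/- Let k = 𝔽_q be a finite field of odd cardinality q, let a ∈ k× be a non-square, let F = k((t)), O = k[[t]], and let γ = [[0, a·t],[t, 0]] ∈ M₂(F) act on F². Then there is exactly one O-lattice Λ in F² with [Λ : O²] = 0 and γΛ ⊆ Λ, namely Λ = O². (Equivalently, the orbital integral O_γ(1_{𝔤(O)}) for SL₂ equals 1.) -/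
open PowerSeries LaurentSeries

lemma finite_quotient_span_X_pow (k : Type) [Field k] [Finite k] (N : ℕ) :
    Finite (k⟦X⟧ ⧸ Ideal.span {(X : k⟦X⟧) ^ N}) := by
  refine Finite.of_surjective
    (fun c : Fin N → k => Ideal.Quotient.mk (Ideal.span {(X : k⟦X⟧) ^ N})
      (PowerSeries.mk fun n => if h : n < N then c ⟨n, h⟩ else 0)) fun q => ?_
  obtain ⟨f, rfl⟩ := Ideal.Quotient.mk_surjective q
  refine ⟨fun i => coeff i f, ?_⟩
  rw [Ideal.Quotient.eq, Ideal.mem_span_singleton, X_pow_dvd_iff]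
  intro m hm
  simp [hm]

lemma finite_of_X_pow_smul_eq_zero {k : Type} [Field k] [Finite k] {Q : Type}
    [AddCommGroup Q] [Module k⟦X⟧ Q] [Module.Finite k⟦X⟧ Q] {N : ℕ}
    (h : ∀ q : Q, (X : k⟦X⟧) ^ N • q = 0) : Finite Q := by
  have ht : Module.IsTorsionBySet k⟦X⟧ Q (Ideal.span {(X : k⟦X⟧) ^ N}) := by
    exact (Module.isTorsionBySet_span_singleton_iff _).2 fun q => h q
  let := ht.module
  have := finite_quotient_span_X_pow k N
  have : IsScalarTower k⟦X⟧ (k⟦X⟧ ⧸ Ideal.span {(X : k⟦X⟧) ^ N}) Q := ht.isScalarTower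
  have : Module.Finite (k⟦X⟧ ⧸ Ideal.span {(X : k⟦X⟧) ^ N}) Q :=
    Module.Finite.of_restrictScalars_finite k⟦X⟧ _ _
  exact Module.finite_of_finite (k⟦X⟧ ⧸ Ideal.span {(X : k⟦X⟧) ^ N})

lemma qdim_eq_zero_of_le {k : Type} [Field k] {V : Type} [AddCommGroup V]
    [Module k⟦X⟧ V] {A B : Submodule k⟦X⟧ V} (h : A ≤ B) : qdim A B = 0 := by
  let := Module.compHom (↥A ⧸ Submodule.comap A.subtype (A ⊓ B))
    (algebraMap k (PowerSeries k))
  have : Subsingleton (↥A ⧸ Submodule.comap A.subtype (A ⊓ B)) := by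
    rw [Submodule.Quotient.subsingleton_iff, inf_eq_left.2 h]
    simp
  exact Module.finrank_zero_of_subsingleton

lemma le_of_qdim_eq_zero {k : Type} [Field k] [Finite k] {V : Type} [AddCommGroup V]
    [Module k⟦X⟧ V] {A B : Submodule k⟦X⟧ V} (hB : B.FG) {N : ℕ}
    (hN : ∀ b ∈ B, (X : k⟦X⟧) ^ N • b ∈ A) (h : qdim B A = 0) : B ≤ A := by
  let := Module.compHom (↥B ⧸ Submodule.comap B.subtype (B ⊓ A))
    (algebraMap k (PowerSeries k))
  have : Module.Finite k⟦X⟧ B := Module.Finite.iff_fg.2 hB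
  have : Finite (↥B ⧸ Submodule.comap B.subtype (B ⊓ A)) := by
    refine finite_of_X_pow_smul_eq_zero (k := k) (N := N) fun q => ?_
    obtain ⟨b, rfl⟩ := Submodule.Quotient.mk_surjective _ q
    rw [← Submodule.Quotient.mk_smul, Submodule.Quotient.mk_eq_zero]
    exact ⟨B.smul_mem _ b.2, hN b b.2⟩
  have h' : Module.finrank k (↥B ⧸ Submodule.comap B.subtype (B ⊓ A)) = 0 := h
  have : Module.Finite k (↥B ⧸ Submodule.comap B.subtype (B ⊓ A)) := Module.Finite.of_finite
  have := Module.finrank_zero_iff.1 h'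
  rw [Submodule.Quotient.subsingleton_iff] at this
  intro b hb
  have hb' : (⟨b, hb⟩ : B) ∈ Submodule.comap B.subtype (B ⊓ A) := this ▸ Submodule.mem_top
  exact hb'.2

lemma mem_stdLat_iff {k : Type} [Field k] {n : ℕ} {v : Fin n → LaurentSeries k} :
    v ∈ stdLat k n ↔ ∀ i, ∃ p : k⟦X⟧, (p : LaurentSeries k) = v i := by
  simp [stdLat, diagLat, tO, Submodule.mem_pi, Submodule.mem_span_singleton, Algebra.smul_def]

lemma stdLat_fg (k : Type) [Field k] (n : ℕ) : (stdLat k n).FG :=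
  Submodule.fg_pi fun _ => Submodule.fg_span_singleton _

lemma isLattice_stdLat (k : Type) [Field k] (n : ℕ) : IsLattice (stdLat k n) := by
  refine ⟨stdLat_fg k n, ?_⟩
  rw [eq_top_iff, ← (Pi.basisFun (LaurentSeries k) (Fin n)).span_eq]
  refine Submodule.span_mono ?_
  rintro _ ⟨i, rfl⟩
  refine mem_stdLat_iff.2 fun j => ?_
  by_cases h : j = i
  · subst h
    exact ⟨1, by simp⟩
  · exact ⟨0, by simp [h]⟩

lemma exists_X_pow_smul_eq {k : Type} [Field k] (x : LaurentSeries k) :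
    ∃ (N : ℕ) (p : k⟦X⟧), (X : k⟦X⟧) ^ N • x = p := by
  obtain ⟨⟨p, _, N, rfl⟩, h⟩ := IsLocalization.surj (Submonoid.powers (X : k⟦X⟧)) x
  exact ⟨N, p, by rw [Algebra.smul_def, mul_comm]; exact h⟩

lemma exists_X_pow_smul_mem_stdLat {k : Type} [Field k] {n : ℕ} (v : Fin n → LaurentSeries k) :
    ∃ N : ℕ, (X : k⟦X⟧) ^ N • v ∈ stdLat k n := by
  choose N p h using fun i => exists_X_pow_smul_eq (v i)
  refine ⟨∑ i, N i, mem_stdLat_iff.2 fun i => ⟨X ^ (∑ j ∈ Finset.univ.erase i, N j) * p i, ?_⟩⟩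
  rw [← Finset.add_sum_erase _ _ (Finset.mem_univ i), add_comm, pow_add, mul_smul, Pi.smul_apply,
    Pi.smul_apply, h]
  simp [Algebra.smul_def]

lemma exists_forall_X_pow_smul_mem_stdLat {k : Type} [Field k] {n : ℕ}
    {Λ : Submodule k⟦X⟧ (Fin n → LaurentSeries k)} (hΛ : Λ.FG) :
    ∃ N : ℕ, ∀ v ∈ Λ, (X : k⟦X⟧) ^ N • v ∈ stdLat k n := by
  induction Λ, hΛ using Submodule.fg_induction with
  | singleton x =>
    obtain ⟨N, hN⟩ := exists_X_pow_smul_mem_stdLat x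
    refine ⟨N, fun v hv => ?_⟩
    obtain ⟨c, rfl⟩ := Submodule.mem_span_singleton.1 hv
    rw [smul_comm]
    exact Submodule.smul_mem _ _ hN
  | sup M₁ M₂ _ _ h₁ h₂ =>
    obtain ⟨N₁, h₁⟩ := h₁
    obtain ⟨N₂, h₂⟩ := h₂
    refine ⟨N₁ + N₂, fun v hv => ?_⟩
    obtain ⟨y, hy, z, hz, rfl⟩ := Submodule.mem_sup.1 hv
    rw [smul_add, pow_add]
    refine add_mem ?_ ?_
    · rw [mul_comm, mul_smul]
      exact Submodule.smul_mem _ _ (h₁ y hy)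
    · rw [mul_smul]
      exact Submodule.smul_mem _ _ (h₂ z hz)

lemma exists_coe_eq_single_mul {k : Type} [Field k] {m : ℤ} (hm : 0 ≤ m) (p : k⟦X⟧) :
    ∃ q : k⟦X⟧, (q : k⸨X⸩) = HahnSeries.single m 1 * (p : k⸨X⸩) := by
  refine ⟨X ^ m.toNat * p, ?_⟩
  rw [coe_mul, HahnSeries.ofPowerSeries_X_pow, Int.toNat_of_nonneg hm]

/-- A pair of Laurent series, not both zero, is a power of `t` times a primitive pair of
power series. -/
lemma exists_eq_single_mul_primitive {k : Type} [Field k] {x y : LaurentSeries k}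
    (h : x ≠ 0 ∨ y ≠ 0) : ∃ (m : ℤ) (p q : k⟦X⟧), x = HahnSeries.single m 1 * (p : k⸨X⸩) ∧
      y = HahnSeries.single m 1 * (q : k⸨X⸩) ∧ (constantCoeff p ≠ 0 ∨ constantCoeff q ≠ 0) := by
  wlog hxy : x ≠ 0 ∧ (y ≠ 0 → x.order ≤ y.order) generalizing x y
  · obtain ⟨m, q, p, hy, hx, h⟩ := this h.symm (by grind)
    exact ⟨m, p, q, hx, hy, h.symm⟩
  obtain ⟨hx, hy⟩ := hxy
  have hc : constantCoeff x.powerSeriesPart ≠ 0 := by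
    rw [← coeff_zero_eq_constantCoeff_apply]
    simpa using hx
  by_cases hy0 : y = 0
  · exact ⟨x.order, x.powerSeriesPart, 0, by simp, by simp [hy0], Or.inl hc⟩
  · obtain ⟨p, hp⟩ := exists_coe_eq_single_mul (sub_nonneg.2 (hy hy0)) y.powerSeriesPart
    refine ⟨x.order, x.powerSeriesPart, p, by simp, ?_, Or.inl hc⟩
    rw [hp, ← mul_assoc, HahnSeries.single_mul_single]
    simp

/-- A primitive vector generates `O²` together with its image under `[[0, a], [1, 0]]`, as the
norm form of the unramified extension `F(√a)` is anisotropic modulo `t`. -/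
lemma single_mul_mem_of_stable {k : Type} [Field k] {a : k} (hsq : ¬ IsSquare a)
    {Λ : Submodule k⟦X⟧ (Fin 2 → LaurentSeries k)}
    (hγ : ∀ x y : k⸨X⸩, ![x, y] ∈ Λ →
      ![HahnSeries.single 1 a * y, HahnSeries.single 1 1 * x] ∈ Λ)
    {m : ℤ} {p q : k⟦X⟧} (hpq : constantCoeff p ≠ 0 ∨ constantCoeff q ≠ 0)
    (hv : ![HahnSeries.single m 1 * (p : k⸨X⸩), HahnSeries.single m 1 * (q : k⸨X⸩)] ∈ Λ)
    {n : ℤ} (hmn : m < n) (r s : k⟦X⟧) :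
    ![HahnSeries.single n 1 * (r : k⸨X⸩), HahnSeries.single n 1 * (s : k⸨X⸩)] ∈ Λ := by
  wlog hn : n = m + 1 generalizing n r s
  · obtain ⟨r', hr⟩ := exists_coe_eq_single_mul (m := n - (m + 1)) (by lia) r
    obtain ⟨s', hs⟩ := exists_coe_eq_single_mul (m := n - (m + 1)) (by lia) s
    have := this (lt_add_one m) r' s' rfl
    rw [hr, hs, ← mul_assoc, ← mul_assoc, HahnSeries.single_mul_single] at this
    simpa using this
  subst hn
  have hu : IsUnit (p ^ 2 - C a * q ^ 2) := by
    rw [isUnit_iff_constantCoeff, isUnit_iff_ne_zero]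
    simp only [map_sub, map_mul, map_pow, constantCoeff_C]
    intro h0
    have h0 := sub_eq_zero.1 h0
    by_cases hq : constantCoeff q = 0
    · simp [hq] at h0 hpq
      exact hpq h0
    · exact hsq ⟨constantCoeff p / constantCoeff q, by field_simp; exact h0.symm⟩
  obtain ⟨w, hw⟩ := hu.exists_right_inv
  have hw' : ((p : k⸨X⸩) ^ 2 - ((C a : k⟦X⟧) : k⸨X⸩) * (q : k⸨X⸩) ^ 2) * (w : k⸨X⸩) = 1 := by
    have := congrArg (HahnSeries.ofPowerSeries ℤ k) hw
    simpa using this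
  have hX : HahnSeries.single (m + 1) (1 : k) = HahnSeries.single 1 1 * HahnSeries.single m 1 := by
    simp [add_comm]
  have ha : HahnSeries.single 1 a = HahnSeries.single 1 1 * ((C a : k⟦X⟧) : k⸨X⸩) := by
    simp
  have hX' : ((X : k⟦X⟧) : k⸨X⸩) = HahnSeries.single 1 1 := by simp
  have key := Λ.add_mem (Λ.smul_mem (w * (r * p - C a * s * q) * X) hv)
    (Λ.smul_mem (w * (s * p - r * q)) (hγ _ _ hv))
  convert key using 1
  ext1 i
  have hs (c : k⟦X⟧) (z : k⸨X⸩) : c • z = (c : k⸨X⸩) * z := Algebra.smul_def c z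
  fin_cases i
  · simp only [Fin.zero_eta, Matrix.cons_val_zero, Pi.add_apply, Pi.smul_apply, hs, hX, ha, hX',
      coe_mul, coe_sub]
    linear_combination (HahnSeries.single 1 1 * HahnSeries.single m 1 * (r : k⸨X⸩)) * -hw'
  · simp only [Fin.mk_one, Matrix.cons_val_one, Matrix.cons_val_fin_one, Pi.add_apply,
      Pi.smul_apply, hs, hX, ha, hX', coe_mul, coe_sub]
    linear_combination (HahnSeries.single 1 1 * HahnSeries.single m 1 * (s : k⸨X⸩)) * -hw'

theorem stmt13 (k : Type) [Field k] [Fintype k] (hodd : Odd (Fintype.card k))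
    (a : k) (ha : a ≠ 0) (hsq : ¬ IsSquare a)
    (γ : Matrix (Fin 2) (Fin 2) (LaurentSeries k))
    (hγ : γ = Matrix.of ![![0, HahnSeries.single 1 a], ![HahnSeries.single 1 1, 0]])
    (Λ : Submodule (PowerSeries k) (Fin 2 → LaurentSeries k)) :
    (IsLattice Λ ∧ relIdx Λ (stdLat k 2) = 0 ∧ ∀ v ∈ Λ, γ.mulVec v ∈ Λ) ↔
      Λ = stdLat k 2 := by
  have hmul (x y : k⸨X⸩) : γ.mulVec ![x, y] =
      ![HahnSeries.single 1 a * y, HahnSeries.single 1 1 * x] := by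
    ext1 i
    fin_cases i <;> simp [hγ, Matrix.mulVec, dotProduct]
  have heta (v : Fin 2 → k⸨X⸩) : v = ![v 0, v 1] := by
    ext1 i
    fin_cases i <;> rfl
  constructor
  · rintro ⟨⟨hfg, hspan⟩, hidx, hst⟩
    have hst' (x y : k⸨X⸩) (h : ![x, y] ∈ Λ) :
        ![HahnSeries.single 1 a * y, HahnSeries.single 1 1 * x] ∈ Λ := hmul x y ▸ hst _ h
    have hmem {v : Fin 2 → k⸨X⸩} (hv : v ∈ Λ) (hv0 : v ≠ 0) :
        ∃ m : ℤ, (0 ≤ m → v ∈ stdLat k 2) ∧ ∀ n : ℤ, m < n → ∀ r s : k⟦X⟧,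
          ![HahnSeries.single n 1 * (r : k⸨X⸩), HahnSeries.single n 1 * (s : k⸨X⸩)] ∈ Λ := by
      have hv0 : v 0 ≠ 0 ∨ v 1 ≠ 0 := by
        by_contra! h
        exact hv0 (by rw [heta v, h.1, h.2]; simp)
      obtain ⟨m, p, q, hp, hq, hpq⟩ := exists_eq_single_mul_primitive hv0
      refine ⟨m, fun hm => mem_stdLat_iff.2 (Fin.forall_fin_two.2 ⟨?_, ?_⟩), ?_⟩
      · exact hp ▸ exists_coe_eq_single_mul hm p
      · exact hq ▸ exists_coe_eq_single_mul hm q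
      · rw [heta v, hp, hq] at hv
        exact fun n hn => single_mul_mem_of_stable hsq hst' hpq hv hn
    by_cases hle : Λ ≤ stdLat k 2
    · have hq : qdim (stdLat k 2) Λ = 0 := by
        simpa [relIdx, qdim_eq_zero_of_le hle] using hidx
      obtain ⟨v, hv, hv0⟩ : ∃ v ∈ Λ, v ≠ 0 := by
        by_contra! h
        have : (Λ : Set (Fin 2 → k⸨X⸩)) ⊆ {0} := fun v hv => h v hv
        have := Submodule.span_mono (R := k⸨X⸩) this
        simp [hspan] at this
      obtain ⟨m, -, hm⟩ := hmem hv hv0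
      refine le_antisymm hle (le_of_qdim_eq_zero (stdLat_fg k 2) (N := (m + 1).toNat) ?_ hq)
      intro b hb
      obtain ⟨r, hr⟩ := mem_stdLat_iff.1 hb 0
      obtain ⟨s, hs⟩ := mem_stdLat_iff.1 hb 1
      have := hm ((m + 1).toNat) (by lia) r s
      rw [← HahnSeries.ofPowerSeries_X_pow, hr, hs] at this
      rw [heta (X ^ (m + 1).toNat • b)]
      exact this
    · obtain ⟨v, hv, hvn⟩ := Set.not_subset.1 hle
      obtain ⟨m, hm, h⟩ := hmem hv (by rintro rfl; exact hvn (zero_mem _))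
      have hle' : stdLat k 2 ≤ Λ := by
        intro b hb
        obtain ⟨r, hr⟩ := mem_stdLat_iff.1 hb 0
        obtain ⟨s, hs⟩ := mem_stdLat_iff.1 hb 1
        rw [heta b, ← hr, ← hs]
        simpa using h 0 (not_le.1 fun h0 => hvn (hm h0)) r s
      have hq : qdim Λ (stdLat k 2) = 0 := by
        simpa [relIdx, qdim_eq_zero_of_le hle'] using hidx
      obtain ⟨N, hN⟩ := exists_forall_X_pow_smul_mem_stdLat hfg
      exact absurd (le_of_qdim_eq_zero hfg hN hq) hle
  · rintro rfl
    refine ⟨isLattice_stdLat k 2, sub_self _, fun v hv => ?_⟩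
    rw [heta v, hmul]
    rw [mem_stdLat_iff] at hv ⊢
    obtain ⟨p, hp⟩ := hv 0
    obtain ⟨q, hq⟩ := hv 1
    intro i
    fin_cases i
    · exact ⟨X * C a * q, by simp [hq]⟩
    · exact ⟨X * p, by simp [hp]⟩
end

section
/- Let k be a field with char k ≠ 2, let a ∈ k× be a non-square, let F = k((t)), and let γ = [[0, a·t],[t, 0]] and γ′ = [[0, a·t²],[1, 0]] in M₂(F). Then γ and γ′ are conjugate by an element of GL₂(F) (indeed diag(t,1)·γ·diag(t,1)^{−1} = γ′), but there is no g ∈ SL₂(F) with g·γ·g^{−1} = γ′. -/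
/-- If the coefficients of `x` vanish below `n`, the coefficient of `x * x` at `n + n` is the
square of the coefficient of `x` at `n`. -/
theorem HahnSeries.coeff_mul_self_add_self {k : Type*} [Semiring k] {x : LaurentSeries k}
    {n : ℤ} (h : ∀ m ∈ x.support, n ≤ m) :
    (x * x).coeff (n + n) = x.coeff n * x.coeff n := by
  rw [HahnSeries.coeff_mul, Finset.sum_eq_single (n, n)]
  · rintro ⟨i, j⟩ hij hne
    rw [Finset.mem_antidiagonal] at hij
    have hi := h i hij.1
    have hj := h j hij.2.1
    have hs : i + j = n + n := hij.2.2
    exact absurd (Prod.ext (by simp only; omega) (by simp only; omega)) hne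
  · intro hn
    by_contra hne
    refine hn (Finset.mem_antidiagonal.2 ⟨?_, ?_, rfl⟩) <;>
      exact fun h0 ↦ hne (by simp [h0])

/-- A nonzero value of the norm form `s² - a r²` with `a` a constant non-square has a nonzero
coefficient in some even degree. -/
theorem LaurentSeries.exists_coeff_normForm_ne_zero {k : Type*} [Field k] {a : k}
    (ha : ¬ IsSquare a) {s r : LaurentSeries k} (h : s ≠ 0 ∨ r ≠ 0) :
    ∃ n : ℤ, (s * s - HahnSeries.C a * (r * r)).coeff (n + n) ≠ 0 := by
  have hwf : (s.support ∪ r.support).IsWF := s.isWF_support.union r.isWF_support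
  have hne : (s.support ∪ r.support).Nonempty := by
    rcases h with h | h
    · exact (HahnSeries.support_nonempty_iff.2 h).inl
    · exact (HahnSeries.support_nonempty_iff.2 h).inr
  refine ⟨hwf.min hne, fun h0 ↦ ?_⟩
  have hmem := hwf.min_mem hne
  rw [HahnSeries.coeff_sub, HahnSeries.C_mul_eq_smul, HahnSeries.coeff_smul,
    HahnSeries.coeff_mul_self_add_self fun m hm ↦ hwf.min_le hne (Or.inl hm),
    HahnSeries.coeff_mul_self_add_self fun m hm ↦ hwf.min_le hne (Or.inr hm), smul_eq_mul] at h0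
  generalize hwf.min hne = n at *
  by_cases hr : r.coeff n = 0
  · have hs : s.coeff n = 0 := by simpa [hr] using h0
    exact hmem.elim (fun h ↦ h hs) (fun h ↦ h hr)
  · refine ha ⟨s.coeff n / r.coeff n, ?_⟩
    field_simp
    linear_combination -h0

theorem stmt18 (k : Type) [Field k] (hchar : (2 : k) ≠ 0)
    (a : k) (ha : a ≠ 0) (hsq : ¬ IsSquare a)
    (γ γ' : Matrix (Fin 2) (Fin 2) (LaurentSeries k))
    (hγ : γ = Matrix.of ![![0, HahnSeries.single 1 a], ![HahnSeries.single 1 1, 0]])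
    (hγ' : γ' = Matrix.of ![![0, HahnSeries.single 2 a], ![1, 0]]) :
    (Matrix.diagonal ![(HahnSeries.single 1 1 : LaurentSeries k), 1]) * γ *
        (Matrix.diagonal ![(HahnSeries.single 1 1 : LaurentSeries k), 1])⁻¹ = γ' ∧
    ¬ ∃ g : Matrix (Fin 2) (Fin 2) (LaurentSeries k),
        g.det = 1 ∧ g * γ * g⁻¹ = γ' := by
  have hT : (HahnSeries.single 1 1 : LaurentSeries k) ≠ 0 := by simp
  have h1 : (HahnSeries.single 1 a : LaurentSeries k) =
      HahnSeries.C a * HahnSeries.single 1 1 := by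
    simp [HahnSeries.C_apply, HahnSeries.single_mul_single]
  have h2 : (HahnSeries.single 2 a : LaurentSeries k) =
      HahnSeries.C a * (HahnSeries.single 1 1 * HahnSeries.single 1 1) := by
    simp [HahnSeries.C_apply, HahnSeries.single_mul_single]
  have hinv : (HahnSeries.single 1 1 : LaurentSeries k) * HahnSeries.single (-1) 1 = 1 := by
    simp [HahnSeries.single_mul_single]
  have hnorm := @LaurentSeries.exists_coeff_normForm_ne_zero k _ a hsq
  rw [h1] at hγ
  rw [h2] at hγ'
  clear h1 h2
  generalize (HahnSeries.single 1 1 : LaurentSeries k) = T at *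
  generalize (HahnSeries.C a : LaurentSeries k) = A at *
  subst hγ hγ'
  constructor
  · have hu : IsUnit (Matrix.diagonal ![T, 1]).det := by simp [Matrix.det_diagonal, hT]
    rw [← Matrix.mul_nonsing_inv_cancel_right (Matrix.diagonal ![T, 1]) (Matrix.of ![![0, A * (T * T)], _]) hu]
    congr 1
    ext i j : 1
    fin_cases i <;> fin_cases j <;>
      simp [Matrix.diagonal_mul, Matrix.mul_diagonal]
    ring
  · rintro ⟨g, hdet, hg⟩
    have hu : IsUnit g.det := by simp [hdet]
    have hcomm := congrArg (· * g) hg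
    simp only [Matrix.nonsing_inv_mul_cancel_right _ _ hu] at hcomm
    have h00 := congrFun (congrFun hcomm 1) 0
    have h11 := congrFun (congrFun hcomm 1) 1
    simp [Matrix.mul_apply, Fin.sum_univ_two] at h00 h11
    rw [Matrix.det_fin_two] at hdet
    have hN : g 1 1 * g 1 1 - A * (g 1 0 * g 1 0) = HahnSeries.single (-1) 1 := by
      refine mul_left_cancel₀ hT ?_
      rw [hinv, ← hdet, ← h00, ← h11]
      ring
    obtain ⟨n, hn⟩ := hnorm (s := g 1 1) (r := g 1 0) (by
        by_contra! h
        simp [h.1, h.2] at hdet)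
    rw [hN, HahnSeries.coeff_single_of_ne (by omega)] at hn
    exact hn rfl
end

section
/- Let k be a field with char k ≠ 2, let n ≥ 1, let X and Y be symmetric n × n matrices over k, let F = k((t)), and let γ ∈ M_{2n}(F) be the block matrix [[0, t·X],[Y, 0]]. Then the characteristic polynomial of γ (a polynomial over F) is separable if and only if X and Y are invertible and the characteristic polynomial of X·Y (a polynomial over k) is separable. -/
namespace Polynomial

variable {K : Type*} [Field K]

theorem isCoprime_X_right_iff {p : K[X]} : IsCoprime p X ↔ p.coeff 0 ≠ 0 := by
  rw [isCoprime_comm, irreducible_X.coprime_iff_not_dvd, X_dvd_iff]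

theorem separable_expand_two_iff (h2 : (2 : K) ≠ 0) {p : K[X]} :
    (expand K 2 p).Separable ↔ p.coeff 0 ≠ 0 ∧ p.Separable := by
  have hu : IsUnit (C (2 : K)) := isUnit_C.2 h2.isUnit
  have hd : derivative (expand K 2 p) = C 2 * (expand K 2 (derivative p) * X) := by
    rw [derivative_expand, map_ofNat C 2]
    push_cast
    ring
  have h0 : (expand K 2 p).coeff 0 = p.coeff 0 := by
    simp [coeff_expand]
  rw [separable_def, hd, isCoprime_mul_unit_left_right hu, IsCoprime.mul_right_iff,
    isCoprime_expand two_ne_zero, isCoprime_X_right_iff, h0, separable_def, and_comm]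

theorem Separable.comp_C_mul_X {p : K[X]} (hp : p.Separable) {a : K} (ha : a ≠ 0) :
    (p.comp (C a * X)).Separable := by
  have hd : derivative (p.comp (C a * X)) = C a * (derivative p).comp (C a * X) := by
    simp [derivative_comp]
  rw [separable_def, hd, isCoprime_mul_unit_left_right (isUnit_C.2 ha.isUnit)]
  exact IsCoprime.map hp (compRingHom (C a * X))

theorem separable_comp_C_mul_X_iff {p : K[X]} {a : K} (ha : a ≠ 0) :
    (p.comp (C a * X)).Separable ↔ p.Separable := by
  refine ⟨fun h => ?_, fun h => h.comp_C_mul_X ha⟩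
  have hinv := h.comp_C_mul_X (inv_ne_zero ha)
  rwa [comp_assoc, mul_comp, C_comp, X_comp, ← mul_assoc, ← C_mul, mul_inv_cancel₀ ha, C_1,
    one_mul, comp_X] at hinv

end Polynomial

namespace Matrix

open Polynomial

variable {m R : Type*} [Fintype m] [DecidableEq m] [CommRing R]

theorem charpoly_smul_comp_C_mul_X (a : R) (A : Matrix m m R) :
    (a • A).charpoly.comp (C a * X) = C (a ^ Fintype.card m) * A.charpoly := by
  have h : (compRingHom (C a * X)).mapMatrix (a • A).charmatrix = C a • A.charmatrix := by
    ext1 i j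
    by_cases hij : i = j
    · subst hij
      simp [charmatrix_apply_eq, mul_sub]
    · simp [charmatrix_apply_ne _ _ _ hij]
  rw [charpoly, charpoly, ← coe_compRingHom_apply, RingHom.map_det, h, det_smul, C_pow]

theorem charpoly_fromBlocks_zero₁₁_zero₂₂ (B D : Matrix m m R) :
    (fromBlocks 0 B D 0).charpoly = expand R 2 (D * B).charpoly := by
  have hx : (expand R 2 : R[X] →+* R[X]).mapMatrix (D * B).charmatrix =
      (X : R[X]) • (X : R[X]) • (1 : Matrix m m R[X]) - D.map C * B.map C := by
    rw [← Matrix.map_mul]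
    ext1 i j
    by_cases hij : i = j
    · subst hij
      simp [charmatrix_apply_eq, pow_two, -Matrix.map_mul]
    · simp [hij, -Matrix.map_mul]
  have hmul : (fromBlocks 0 B D 0).charmatrix *
      fromBlocks 1 (B.map C) 0 ((X : R[X]) • (1 : Matrix m m R[X])) =
      fromBlocks ((X : R[X]) • (1 : Matrix m m R[X])) 0 (-D.map C)
        ((expand R 2 : R[X] →+* R[X]).mapMatrix (D * B).charmatrix) := by
    rw [hx, charmatrix_fromBlocks, charmatrix_zero, fromBlocks_multiply]
    congr 1 <;> simp [scalar_apply, ← smul_one_eq_diagonal, sub_eq_neg_add]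
  have hdet := congrArg det hmul
  rw [det_mul, det_fromBlocks_zero₂₁, det_fromBlocks_zero₁₂, det_one, one_mul, det_smul, det_one,
    mul_one, mul_comm, ← RingHom.map_det] at hdet
  exact (isRegular_X_pow _).left hdet

theorem charpoly_coeff_zero_ne_zero_iff {K : Type*} [Field K] (A : Matrix m m K) :
    A.charpoly.coeff 0 ≠ 0 ↔ A.det ≠ 0 := by
  simp [det_eq_sign_charpoly_coeff]

theorem separable_charpoly_smul_iff {K : Type*} [Field K] {a : K} (ha : a ≠ 0)
    (A : Matrix m m K) : (a • A).charpoly.Separable ↔ A.charpoly.Separable := by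
  rw [← separable_comp_C_mul_X_iff ha, charpoly_smul_comp_C_mul_X]
  exact (associated_unit_mul_left _ _ (isUnit_C.2 (pow_ne_zero _ ha).isUnit)).separable_iff

end Matrix


theorem stmt19 (k : Type) [Field k] (hchar : (2 : k) ≠ 0) (n : ℕ) (hn : 1 ≤ n)
    (X Y : Matrix (Fin n) (Fin n) k) (hX : X.IsSymm) (hY : Y.IsSymm)
    (γ : Matrix (Fin n ⊕ Fin n) (Fin n ⊕ Fin n) (LaurentSeries k))
    (hγ : γ = Matrix.fromBlocks 0
      ((HahnSeries.single 1 1 : LaurentSeries k) •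
        X.map (algebraMap k (LaurentSeries k)))
      (Y.map (algebraMap k (LaurentSeries k))) 0) :
    γ.charpoly.Separable ↔
      (IsUnit X.det ∧ IsUnit Y.det ∧ (X * Y).charpoly.Separable) := by
  have ht : (HahnSeries.single 1 1 : LaurentSeries k) ≠ 0 :=
    HahnSeries.single_ne_zero one_ne_zero
  have h2 : (2 : LaurentSeries k) ≠ 0 := by
    rw [← map_ofNat (algebraMap k (LaurentSeries k)) 2]
    exact (map_ne_zero _).2 hchar
  rw [hγ, Matrix.charpoly_fromBlocks_zero₁₁_zero₂₂, Polynomial.separable_expand_two_iff h2,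
    Matrix.charpoly_coeff_zero_ne_zero_iff, Matrix.mul_smul,
    Matrix.separable_charpoly_smul_iff ht, ← Matrix.map_mul, Matrix.charpoly_map,
    Polynomial.separable_map, Matrix.charpoly_mul_comm, Matrix.det_smul, ← RingHom.mapMatrix_apply,
    ← RingHom.map_det, Matrix.det_mul]
  simp only [isUnit_iff_ne_zero, ne_eq, mul_eq_zero, map_eq_zero]
  have := pow_ne_zero (Fintype.card (Fin n)) ht
  tauto
end
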